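/- arXiv:0809.2068 — 6 statements merged into one kernel-verified Lean document; each statement's English description precedes it below -/
import Mathlib

section
/- Let R be a commutative Noetherian ring and let B = ⊕_{i,j≥0} B_{i,j} be a finitely generated bigraded R-algebra with B_{0,0} = R. Set B_x = ⊕_{i≥0} B_{i,0} and B_y = ⊕_{j≥0} B_{0,j}. Let V = ⊕_{i,j≥0} V_{i,j} be a bigraded B-module such that: (1) each V_{i,j} is a finitely generated R-module; (2) for each i ≥ 0, the column ⊕_{j≥0} V_{i,j} is finitely generated as a B_y-module; (3) for each j ≥ 0, the row ⊕_{i≥0} V_{i,j} is finitely generated as a B_x-module; (4) there exists a homogeneous element z ∈ B_{r,0} with r ≥ 1 and an exact sequence of bigraded B-modules V(-r,0) →^{z} V →^{ψ} D, where D is a finitely generated bigraded B-module and the first map is multiplication by z. Then V is a finitely generated B-module. -/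
/-- Let `R` be Noetherian, `B` a finitely generated bigraded `R`-algebra with
`B_{(0,0)} = R`, and `V` a bigraded `B`-module such that: (1) each component `V_{i,j}` is a
finitely generated `R`-module; (2) each column `⊕_j V_{i,j}` is finitely generated over
`B_y = ⊕_j B_{(0,j)}`; (3) each row `⊕_i V_{i,j}` is finitely generated over
`B_x = ⊕_i B_{(i,0)}`; (4) there are `z ∈ B_{(r,0)}` with `r ≥ 1` and an exact sequence of
bigraded `B`-modules `V(-r,0) →^z V →^ψ D` with `D` a finitely generated bigraded `B`-module.
Then `V` is a finitely generated `B`-module. -/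
theorem stmt1 (R B V D : Type) [CommRing R] [IsNoetherianRing R]
    [CommRing B] [Algebra R B] [Algebra.FiniteType R B]
    (𝒜 : ℕ × ℕ → Submodule R B) [GradedAlgebra 𝒜]
    (h00 : 𝒜 (0, 0) = (1 : Submodule R B))
    [AddCommGroup V] [Module R V] [Module B V] [IsScalarTower R B V]
    (ℳ : ℕ × ℕ → Submodule R V) [DirectSum.Decomposition ℳ]
    (hgrV : ∀ (p q : ℕ × ℕ), ∀ b ∈ 𝒜 p, ∀ v ∈ ℳ q, b • v ∈ ℳ (p + q))
    (h1 : ∀ p : ℕ × ℕ, Module.Finite R (ℳ p))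
    -- (2) each column is a finitely generated module over `B_y = ⊕_{j} B_{(0,j)}`
    (h2 : ∀ i : ℕ, ∃ s : Finset V,
      (↑s : Set V) ⊆ (⨆ j : ℕ, ℳ (i, j) : Submodule R V) ∧
      ∀ v ∈ (⨆ j : ℕ, ℳ (i, j) : Submodule R V),
        v ∈ Submodule.span (Algebra.adjoin R (⋃ j : ℕ, (𝒜 (0, j) : Set B))) (↑s : Set V))
    -- (3) each row is a finitely generated module over `B_x = ⊕_{i} B_{(i,0)}`
    (h3 : ∀ j : ℕ, ∃ s : Finset V,
      (↑s : Set V) ⊆ (⨆ i : ℕ, ℳ (i, j) : Submodule R V) ∧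
      ∀ v ∈ (⨆ i : ℕ, ℳ (i, j) : Submodule R V),
        v ∈ Submodule.span (Algebra.adjoin R (⋃ i : ℕ, (𝒜 (i, 0) : Set B))) (↑s : Set V))
    -- (4) the exact sequence `V(-r,0) →^z V →^ψ D`
    [AddCommGroup D] [Module R D] [Module B D] [IsScalarTower R B D]
    (𝒟 : ℕ × ℕ → Submodule R D) [DirectSum.Decomposition 𝒟]
    (hgrD : ∀ (p q : ℕ × ℕ), ∀ b ∈ 𝒜 p, ∀ d ∈ 𝒟 q, b • d ∈ 𝒟 (p + q))
    [Module.Finite B D]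
    (r : ℕ) (hr : 1 ≤ r) (z : B) (hz : z ∈ 𝒜 (r, 0))
    (ψ : V →ₗ[B] D)
    (hψgr : ∀ (p : ℕ × ℕ), ∀ v ∈ ℳ p, ψ v ∈ 𝒟 p)
    (hexact : ∀ v : V, ψ v = 0 ↔ ∃ w : V, v = z • w) :
    Module.Finite B V := by
  classical
  have hB : IsNoetherianRing B := Algebra.FiniteType.isNoetherianRing R B
  -- components of a product with a homogeneous scalar
  have key : ∀ (p : ℕ × ℕ) (b : B), b ∈ 𝒜 p → ∀ (w : V) (q : ℕ × ℕ),
      (DirectSum.decompose ℳ (b • w) q : V) =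
        if p ≤ q then b • (DirectSum.decompose ℳ w (q - p) : V) else 0 := by
    intro p b hb w q
    induction w using DirectSum.Decomposition.inductionOn ℳ with
    | zero => simp
    | @homogeneous m w =>
      have hm := hgrV p m b hb w w.2
      by_cases hq : p + m = q
      · subst hq
        rw [DirectSum.decompose_of_mem_same ℳ hm, if_pos le_self_add, add_tsub_cancel_left,
          DirectSum.decompose_of_mem_same ℳ w.2]
      · rw [DirectSum.decompose_of_mem_ne ℳ hm hq]
        split_ifs with h
        · rw [DirectSum.decompose_of_mem_ne ℳ w.2, smul_zero]
          rintro rfl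
          exact hq (add_tsub_cancel_of_le h)
        · rfl
    | add x y hx hy =>
      rw [smul_add, DirectSum.decompose_add, DirectSum.add_apply, Submodule.coe_add, hx, hy,
        DirectSum.decompose_add, DirectSum.add_apply, Submodule.coe_add, smul_add]
      split_ifs <;> simp
  -- lifts of generators of the image
  obtain ⟨T, hT⟩ : (LinearMap.range ψ).FG := IsNoetherian.noetherian _
  have hTr : (↑T : Set D) ⊆ ψ '' Set.univ := by
    intro d hd
    have : d ∈ LinearMap.range ψ := hT ▸ Submodule.subset_span hd
    simpa using this
  obtain ⟨S, -, hS⟩ := Finset.subset_set_image_iff.1 hTr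
  let G : Finset V := S.biUnion fun s =>
    (DirectSum.decompose ℳ s).support.image fun p => (DirectSum.decompose ℳ s p : V)
  let N : Submodule B V := Submodule.span B (↑G : Set V)
  have hGmem : ∀ s ∈ S, ∀ p, (DirectSum.decompose ℳ s p : V) ∈ N := by
    intro s hs p
    by_cases h : DirectSum.decompose ℳ s p = 0
    · rw [h]; simp
    · apply Submodule.subset_span
      simp only [G, Finset.coe_biUnion, Set.mem_iUnion, Finset.coe_image]
      exact ⟨s, hs, p, by simpa using h, rfl⟩
  have hSN : ∀ s ∈ S, s ∈ N := by
    intro s hs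
    rw [← DirectSum.sum_support_decompose ℳ s]
    exact Submodule.sum_mem _ fun p _ => hGmem s hs p
  have hNh : ∀ x ∈ N, ∀ q, (DirectSum.decompose ℳ x q : V) ∈ N := by
    intro x hx
    induction hx using Submodule.span_induction with
    | mem x hx =>
      intro q
      simp only [G, Finset.coe_biUnion, Set.mem_iUnion, Finset.coe_image] at hx
      obtain ⟨s, hs, p, -, rfl⟩ := hx
      by_cases h : p = q
      · subst h
        rw [DirectSum.decompose_of_mem_same ℳ (SetLike.coe_mem _)]
        exact hGmem s hs p
      · rw [DirectSum.decompose_of_mem_ne ℳ (SetLike.coe_mem _) h]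
        exact N.zero_mem
    | zero => intro q; simp
    | add x y _ _ hx hy =>
      intro q
      rw [DirectSum.decompose_add, DirectSum.add_apply, Submodule.coe_add]
      exact N.add_mem (hx q) (hy q)
    | smul b x _ hx =>
      induction b using DirectSum.Decomposition.inductionOn 𝒜 with
      | zero => intro q; simp
      | @homogeneous m b =>
        intro q
        rw [key m b b.2]
        split_ifs
        · exact N.smul_mem _ (hx _)
        · exact N.zero_mem
      | add b c hb hc =>
        intro q
        rw [add_smul, DirectSum.decompose_add, DirectSum.add_apply, Submodule.coe_add]
        exact N.add_mem (hb q) (hc q)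
  have hdec : ∀ v : V, ∃ n ∈ N, ∃ w, v = n + z • w := by
    intro v
    have hv : ψ v ∈ Submodule.map ψ N := by
      have h1 : ψ v ∈ Submodule.span B (↑T : Set D) := hT ▸ LinearMap.mem_range_self ψ v
      refine Submodule.span_le.2 ?_ h1
      intro d hd
      rw [← hS] at hd
      simp only [Finset.coe_image] at hd
      obtain ⟨s, hs, rfl⟩ := hd
      exact Submodule.mem_map_of_mem (hSN s hs)
    obtain ⟨n, hn, hnv⟩ := hv
    obtain ⟨w, hw⟩ := (hexact (v - n)).1 (by rw [map_sub, hnv, sub_self])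
    exact ⟨n, hn, w, by rw [← hw]; abel⟩
  have hhom : ∀ k : ℕ, ∀ q : ℕ × ℕ, q.1 = k → ∀ v ∈ ℳ q, v ∈ N := by
    intro k
    induction k using Nat.strong_induction_on with
    | _ k ih =>
      intro q hq v hv
      obtain ⟨n, hn, w, hw⟩ := hdec v
      have h := DirectSum.decompose_of_mem_same ℳ hv
      rw [hw, DirectSum.decompose_add, DirectSum.add_apply, Submodule.coe_add,
        key (r, 0) z hz, ← hw] at h
      rw [← h]
      refine N.add_mem (hNh n hn q) ?_
      split_ifs with hle
      · refine N.smul_mem _ (ih (q - (r, 0)).1 ?_ _ rfl _ (SetLike.coe_mem _))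
        have h2 : r ≤ q.1 := hle.1
        change q.1 - r < k
        omega
      · exact N.zero_mem
  refine ⟨⟨G, ?_⟩⟩
  rw [eq_top_iff]
  intro v _
  rw [← DirectSum.sum_support_decompose ℳ v]
  exact Submodule.sum_mem _ fun p _ => hhom p.1 p rfl _ (SetLike.coe_mem _)
end

section
/- Let A be a commutative Noetherian ring, S an A-algebra, and U an S-module. Suppose that the support Supp_A U = { 𝔭 ∈ Spec A : U_𝔭 ≠ 0 } is a finite set, and that for every prime 𝔭 of A the localization U_𝔭 is a finitely generated S_𝔭-module. Then U is a finitely generated S-module. -/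
lemma local_gens {S U : Type} [CommRing S] [AddCommGroup U] [Module S U] (M : Submonoid S)
    (h : Module.Finite (Localization M) (LocalizedModule M U)) :
    ∃ F : Finset U, ∀ u : U, ∃ m ∈ M, m • u ∈ Submodule.span S (F : Set U) := by
  classical
  obtain ⟨s, hs⟩ := h.fg_top
  refine ⟨IsLocalizedModule.finsetIntegerMultiple M (LocalizedModule.mkLinearMap M U) s,
    fun u => ?_⟩
  have hu : LocalizedModule.mkLinearMap M U u ∈
      Submodule.span (Localization M) (s : Set (LocalizedModule M U)) := by rw [hs]; trivial
  obtain ⟨⟨t, ht⟩, hy⟩ := multiple_mem_span_of_mem_localization_span M (Localization M) _ _ hu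
  rw [Submonoid.smul_def, ← map_smul] at hy
  obtain ⟨⟨m, hm⟩, hy⟩ := IsLocalizedModule.smul_mem_finsetIntegerMultiple_span M _ _ _ hy
  exact ⟨m * t, M.mul_mem hm ht, by simpa [Submonoid.smul_def, mul_smul] using hy⟩

/-- Let `A` be Noetherian, `S` an `A`-algebra and `U` an `S`-module.  If the
support `Supp_A U` is finite, and for every prime `p` of `A` the localization `U_p` is a
finitely generated `S_p`-module, then `U` is a finitely generated `S`-module. -/
theorem stmt2 (A S U : Type) [CommRing A] [IsNoetherianRing A] [CommRing S] [Algebra A S]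
    [AddCommGroup U] [Module A U] [Module S U] [IsScalarTower A S U]
    (hsupp : (Module.support A U).Finite)
    (hloc : ∀ (p : Ideal A) [p.IsPrime],
      Module.Finite (Localization (Algebra.algebraMapSubmonoid S p.primeCompl))
        (LocalizedModule (Algebra.algebraMapSubmonoid S p.primeCompl) U)) :
    Module.Finite S U := by
  classical
  choose F hF using fun p : PrimeSpectrum A => local_gens _ (hloc p.asIdeal)
  refine ⟨⟨hsupp.toFinset.biUnion F, ?_⟩⟩
  set N := Submodule.span S ((hsupp.toFinset.biUnion F : Finset U) : Set U) with hN
  rw [eq_top_iff]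
  rintro u -
  let I : Ideal A := (N.restrictScalars A).comap (LinearMap.toSpanSingleton A U u)
  have hI : I = ⊤ := by
    by_contra hne
    obtain ⟨p, hp, hIp⟩ := Ideal.exists_le_maximal I hne
    let P : PrimeSpectrum A := ⟨p, hp.isPrime⟩
    by_cases hP : P ∈ Module.support A U
    · obtain ⟨_, ⟨a, ha, rfl⟩, hau⟩ := hF P u
      refine ha (hIp ?_)
      change a • u ∈ N
      rw [← algebraMap_smul S a u]
      refine Submodule.span_mono ?_ hau
      exact_mod_cast Finset.subset_biUnion_of_mem F (hsupp.mem_toFinset.mpr hP)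
    · obtain ⟨a, ha, hau⟩ := Module.notMem_support_iff'.mp hP u
      refine ha (hIp ?_)
      change a • u ∈ N
      rw [hau]
      exact N.zero_mem
  have h1 : (1 : A) ∈ I := hI ▸ Submodule.mem_top
  have h2 : (1 : A) • u ∈ N := h1
  simpa using h2
end

section
/- Let A be a commutative Noetherian ring and let R = ⊕_{n≥0} R_n be a standard graded A-algebra (that is, R_0 = A and R is generated as an A-algebra by R_1). Let N = ⊕_{n≥0} N_n be a finitely generated graded R-module. Then ann_A N_n ⊆ ann_A N_{n+1} for all sufficiently large n, and there exists n_0 such that ann_A N_n = ann_A N_{n_0} for all n ≥ n_0. -/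
/-- Let `A` be Noetherian and `R = ⊕_{n ≥ 0} R_n` a standard graded
`A`-algebra (`R_0 = A` and `R` is generated over `A` by `R_1`).  If `N = ⊕_{n ≥ 0} N_n`
is a finitely generated graded `R`-module, then `ann_A N_n ⊆ ann_A N_{n+1}` for all large `n`,
and there is `n₀` with `ann_A N_n = ann_A N_{n₀}` for all `n ≥ n₀`. -/
theorem stmt3 (A R N : Type) [CommRing A] [IsNoetherianRing A] [CommRing R] [Algebra A R]
    (𝒜 : ℕ → Submodule A R) [GradedAlgebra 𝒜]
    (h0 : 𝒜 0 = (1 : Submodule A R))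
    (hstd : Algebra.adjoin A ((𝒜 1 : Submodule A R) : Set R) = ⊤)
    [AddCommGroup N] [Module A N] [Module R N] [IsScalarTower A R N]
    (ℳ : ℕ → Submodule A N) [DirectSum.Decomposition ℳ]
    (hgr : ∀ (m n : ℕ), ∀ r ∈ 𝒜 m, ∀ x ∈ ℳ n, r • x ∈ ℳ (m + n))
    [Module.Finite R N] :
    (∃ n₁ : ℕ, ∀ n ≥ n₁,
      Module.annihilator A (ℳ n) ≤ Module.annihilator A (ℳ (n + 1))) ∧
    (∃ n₀ : ℕ, ∀ n ≥ n₀,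
      Module.annihilator A (ℳ n) = Module.annihilator A (ℳ n₀)) := by
  classical
  -- every product of degree one elements is in degree zero or factors
  have hmon : ∀ m ∈ Submonoid.closure ((𝒜 1 : Submodule A R) : Set R),
      m ∈ 𝒜 0 ∨ ∃ k, ∃ r ∈ 𝒜 1, ∃ m' ∈ 𝒜 k, m = r * m' := by
    intro m hm
    induction hm using Submonoid.closure_induction_left with
    | one => exact Or.inl (SetLike.GradedOne.one_mem)
    | mul_left x hx y hy ih =>
      right
      rcases ih with h | ⟨k, r, hr, m', hm', rfl⟩
      · exact ⟨0, x, hx, y, h, rfl⟩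
      · exact ⟨1 + k, x, hx, r * m', SetLike.GradedMul.mul_mem hr hm', rfl⟩
  have hspan : Submodule.span A (Submonoid.closure ((𝒜 1 : Submodule A R) : Set R) : Set R) = ⊤ := by
    rw [← Algebra.adjoin_eq_span, hstd, Algebra.top_toSubmodule]
  obtain ⟨S, hS⟩ := (Module.Finite.fg_top : (⊤ : Submodule R N).FG)
  obtain ⟨D, hD⟩ : ∃ D : ℕ, ∀ s ∈ S, ∀ d, D < d → DirectSum.decompose ℳ s d = 0 := by
    refine ⟨S.sup (fun s => (DirectSum.decompose ℳ s).support.sup id), ?_⟩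
    intro s hs d hd
    by_contra hne
    have h1 : d ≤ (DirectSum.decompose ℳ s).support.sup id :=
      Finset.le_sup (f := id) (DFinsupp.mem_support_iff.mpr hne)
    have h2 := Finset.le_sup (f := fun s => (DirectSum.decompose ℳ s).support.sup id) hs
    exact absurd hd (not_lt.mpr (h1.trans h2))
  have key : ∀ n ≥ D, Module.annihilator A (ℳ n) ≤ Module.annihilator A (ℳ (n + 1)) := by
    intro n hn a ha
    rw [Module.mem_annihilator] at ha ⊢
    have ha' : ∀ x ∈ ℳ n, a • x = 0 := fun x hx => congrArg Subtype.val (ha ⟨x, hx⟩)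
    let T : Submodule A N :=
      { carrier := {x | a • ((DirectSum.decompose ℳ x (n + 1) : ℳ (n + 1)) : N) = 0}
        zero_mem' := by simp
        add_mem' := by
          intro x y hx hy
          simp only [Set.mem_ofPred_eq] at hx hy ⊢
          simp [DirectSum.decompose_add, smul_add, hx, hy]
        smul_mem' := by
          intro c x hx
          simp only [Set.mem_ofPred_eq] at hx ⊢
          rw [DirectSum.decompose_smul, DirectSum.smul_apply, Submodule.coe_smul, smul_comm, hx,
            smul_zero] }
    have hT : ∀ x, x ∈ T ↔ a • ((DirectSum.decompose ℳ x (n + 1) : ℳ (n + 1)) : N) = 0 :=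
      fun x => Iff.rfl
    have hhom : ∀ d ≤ D, ∀ x ∈ ℳ d, ∀ r : R, r • x ∈ T := by
      intro d hd x hx r
      have hr : r ∈ Submodule.span A
          (Submonoid.closure ((𝒜 1 : Submodule A R) : Set R) : Set R) := by
        rw [hspan]; trivial
      induction hr using Submodule.span_induction with
      | mem m hm =>
        rw [hT]
        rcases hmon m hm with h | ⟨k, r, hr, m', hm', rfl⟩
        · have := hgr 0 d m h x hx
          rw [DirectSum.decompose_of_mem_ne ℳ this (by omega), smul_zero]
        · have h1 := hgr k d m' hm' x hx
          have h2 := hgr 1 (k + d) r hr _ h1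
          rw [mul_smul]
          by_cases hk : k + d = n
          · rw [hk, add_comm] at h2
            rw [DirectSum.decompose_of_mem_same ℳ h2]
            rw [← smul_algebra_smul_comm, ha' _ (hk ▸ h1), smul_zero]
          · rw [DirectSum.decompose_of_mem_ne ℳ h2 (by omega), smul_zero]
      | zero => rw [zero_smul]; exact T.zero_mem
      | add p q _ _ hp hq => rw [add_smul]; exact T.add_mem hp hq
      | smul c p _ hp => rw [smul_assoc]; exact T.smul_mem c hp
    have hall : ∀ x : N, ∀ r : R, r • x ∈ T := by
      intro x
      have hx : x ∈ Submodule.span R (S : Set N) := by rw [hS]; trivial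
      induction hx using Submodule.span_induction with
      | mem s hs =>
        intro r
        rw [← DirectSum.sum_support_decompose ℳ s, Finset.smul_sum]
        refine T.sum_mem fun d _ => ?_
        by_cases hd : d ≤ D
        · exact hhom d hd _ (SetLike.coe_mem _) r
        · rw [hD s hs d (by omega)]
          simp
      | zero => intro r; rw [smul_zero]; exact T.zero_mem
      | add p q _ _ hp hq => intro r; rw [smul_add]; exact T.add_mem (hp r) (hq r)
      | smul c p _ hp => intro r; rw [← mul_smul]; exact hp _
    rintro ⟨x, hx⟩
    have := hall x 1
    rw [one_smul, hT, DirectSum.decompose_of_mem_same ℳ hx] at this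
    exact Subtype.ext this
  refine ⟨⟨D, key⟩, ?_⟩
  let f : ℕ →o Ideal A :=
    ⟨fun k => Module.annihilator A (ℳ (D + k)),
      monotone_nat_of_le_succ fun k => key (D + k) (by omega)⟩
  obtain ⟨k, hk⟩ := monotone_stabilizes_iff_noetherian.mpr ‹IsNoetherianRing A› f
  refine ⟨D + k, fun n hn => ?_⟩
  have := hk (n - D) (by omega)
  have h2 : D + (n - D) = n := by omega
  change Module.annihilator A (ℳ (D + k)) = Module.annihilator A (ℳ (D + (n - D))) at this
  rw [h2] at this
  exact this.symm
end

section
/- Let A be a commutative Noetherian ring and let R = A[x_1,…,x_r; y_1,…,y_s] be the bigraded polynomial ring over A with deg x_i = (1,0) for each i and deg y_j = (0,2) for each j. Let D = ⊕_{i,j≥0} D_{i,j} be a finitely generated bigraded R-module and set l = r·s. Then there exist i_0, j_0 such that for all i ≥ i_0 and j ≥ j_0 there is an injective A-module homomorphism D_{(i,j)} ↪ (D_{(i+1,j+2)})^l. -/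
/-- The weight function making `A[x_1,…,x_r; y_1,…,y_s]` bigraded with
`deg xᵢ = (1,0)` and `deg yⱼ = (0,2)`. -/
def stmt4Weight (r s : ℕ) : Fin r ⊕ Fin s → ℕ × ℕ :=
  Sum.elim (fun _ => (1, 0)) (fun _ => (0, 2))

theorem stmt4_monomial_comp {A : Type} [CommRing A] {r s : ℕ}
    {D : Type} [AddCommGroup D] [Module A D]
    [Module (MvPolynomial (Fin r ⊕ Fin s) A) D]
    (𝒟 : ℕ × ℕ → Submodule A D) [DirectSum.Decomposition 𝒟]
    (hgr : ∀ (p q : ℕ × ℕ),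
      ∀ f ∈ MvPolynomial.weightedHomogeneousSubmodule A (stmt4Weight r s) p,
      ∀ d ∈ 𝒟 q, f • d ∈ 𝒟 (p + q))
    (p t : ℕ × ℕ) (f : MvPolynomial (Fin r ⊕ Fin s) A)
    (hf : f ∈ MvPolynomial.weightedHomogeneousSubmodule A (stmt4Weight r s) p) (d : D)
    (h : ∀ q, p + q = t → (DirectSum.decompose 𝒟 d q : D) = 0) :
    (DirectSum.decompose 𝒟 (f • d) t : D) = 0 := by
  classical
  have e : f • d = ∑ q ∈ (DirectSum.decompose 𝒟 d).support,
      f • (DirectSum.decompose 𝒟 d q : D) := by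
    rw [← Finset.smul_sum, DirectSum.sum_support_decompose]
  rw [e, DirectSum.decompose_sum, DFinsupp.finsetSum_apply, AddSubmonoidClass.coe_finsetSum]
  refine Finset.sum_eq_zero fun q _ => ?_
  by_cases hq : p + q = t
  · rw [h q hq, smul_zero, DirectSum.decompose_zero]; rfl
  · exact DirectSum.decompose_of_mem_ne 𝒟 (hgr p q f hf _ (SetLike.coe_mem _)) hq

theorem stmt4_weight_fst {r s : ℕ} (m : Fin r ⊕ Fin s →₀ ℕ) (h : ∀ a, m (Sum.inl a) = 0) :
    (Finsupp.weight (stmt4Weight r s) m).1 = 0 := by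
  rw [Finsupp.weight_apply, Finsupp.sum, Prod.fst_sum]
  refine Finset.sum_eq_zero fun x _ => ?_
  rcases x with a | b
  · simp [h a]
  · simp [stmt4Weight]

theorem stmt4_weight_snd {r s : ℕ} (m : Fin r ⊕ Fin s →₀ ℕ) (h : ∀ a, m (Sum.inr a) = 0) :
    (Finsupp.weight (stmt4Weight r s) m).2 = 0 := by
  rw [Finsupp.weight_apply, Finsupp.sum, Prod.snd_sum]
  refine Finset.sum_eq_zero fun x _ => ?_
  rcases x with a | b
  · simp [stmt4Weight]
  · simp [h b]

theorem stmt4_XY {A : Type} [CommRing A] {r s : ℕ} (a : Fin r) (b : Fin s) :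
    (MvPolynomial.X (Sum.inl a) * MvPolynomial.X (Sum.inr b) : MvPolynomial (Fin r ⊕ Fin s) A) ∈
      MvPolynomial.weightedHomogeneousSubmodule A (stmt4Weight r s) (1, 2) := by
  rw [MvPolynomial.mem_weightedHomogeneousSubmodule]
  exact (MvPolynomial.isWeightedHomogeneous_X A (stmt4Weight r s) (Sum.inl a)).mul
    (MvPolynomial.isWeightedHomogeneous_X A (stmt4Weight r s) (Sum.inr b))

theorem stmt4_dvd {A : Type} [CommRing A] {r s : ℕ} (m : Fin r ⊕ Fin s →₀ ℕ) (c : A)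
    (a : Fin r) (b : Fin s) (ha : m (Sum.inl a) ≠ 0) (hb : m (Sum.inr b) ≠ 0) :
    (MvPolynomial.X (Sum.inl a) * MvPolynomial.X (Sum.inr b) : MvPolynomial (Fin r ⊕ Fin s) A) ∣
      MvPolynomial.monomial m c := by
  classical
  refine ⟨MvPolynomial.monomial
    (m - (Finsupp.single (Sum.inl a) 1 + Finsupp.single (Sum.inr b) 1)) c, ?_⟩
  rw [MvPolynomial.X, MvPolynomial.X, MvPolynomial.monomial_mul, MvPolynomial.monomial_mul,
    add_tsub_cancel_of_le, one_mul, one_mul]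
  intro x
  rcases x with x | x
  · by_cases hx : a = x
    · subst hx; simp; omega
    · simp [hx]
  · by_cases hx : b = x
    · subst hx; simp; omega
    · simp [hx]

/-- Let `A` be Noetherian and `R = A[x_1,…,x_r; y_1,…,y_s]` the bigraded
polynomial ring with `deg xᵢ = (1,0)`, `deg yⱼ = (0,2)`.  If `D = ⊕ D_{i,j}` is a finitely
generated bigraded `R`-module and `l = r·s`, then there are `i₀, j₀` such that for all
`i ≥ i₀` and `j ≥ j₀` there is an injective `A`-linear map `D_{(i,j)} ↪ (D_{(i+1,j+2)})^l`. -/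
theorem stmt4 (A : Type) [CommRing A] [IsNoetherianRing A] (r s : ℕ)
    (D : Type) [AddCommGroup D] [Module A D]
    [Module (MvPolynomial (Fin r ⊕ Fin s) A) D]
    [IsScalarTower A (MvPolynomial (Fin r ⊕ Fin s) A) D]
    [Module.Finite (MvPolynomial (Fin r ⊕ Fin s) A) D]
    (𝒟 : ℕ × ℕ → Submodule A D) [DirectSum.Decomposition 𝒟]
    (hgr : ∀ (p q : ℕ × ℕ),
      ∀ f ∈ MvPolynomial.weightedHomogeneousSubmodule A (stmt4Weight r s) p,
      ∀ d ∈ 𝒟 q, f • d ∈ 𝒟 (p + q)) :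
    ∃ i₀ j₀ : ℕ, ∀ i ≥ i₀, ∀ j ≥ j₀,
      ∃ φ : (𝒟 (i, j)) →ₗ[A] (Fin (r * s) → (𝒟 (i + 1, j + 2))),
        Function.Injective φ := by
  classical
  let R := MvPolynomial (Fin r ⊕ Fin s) A
  let xy : Fin r → Fin s → R := fun a b => MvPolynomial.X (Sum.inl a) * MvPolynomial.X (Sum.inr b)
  let K : Submodule R D := ⨅ a, ⨅ b, LinearMap.ker (LinearMap.lsmul R D (xy a b))
  have hK : ∀ d, d ∈ K ↔ ∀ a b, xy a b • d = 0 := by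
    intro d; simp [K, Submodule.mem_iInf]
  have : IsNoetherian R D := isNoetherian_of_isNoetherianRing_of_finite R D
  obtain ⟨G, hG⟩ := IsNoetherian.noetherian K
  have hbd : BddAbove ((G.biUnion fun g => (DirectSum.decompose 𝒟 g).support : Finset (ℕ × ℕ)) :
      Set (ℕ × ℕ)) := Finset.bddAbove _
  obtain ⟨N, hN⟩ := hbd
  have hN' : ∀ g ∈ G, ∀ q, (DirectSum.decompose 𝒟 g q : D) ≠ 0 → q ≤ N := by
    intro g hg q hq
    apply hN
    rw [Finset.mem_coe, Finset.mem_biUnion]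
    refine ⟨g, hg, ?_⟩
    rw [DFinsupp.mem_support_iff]
    intro h; apply hq; rw [h]; rfl
  have hgen : ∀ g ∈ G, ∀ f : R, ∀ t : ℕ × ℕ, N.1 < t.1 → N.2 < t.2 →
      (DirectSum.decompose 𝒟 (f • g) t : D) = 0 := by
    intro g hg f t h1 h2
    have hgK : g ∈ K := hG ▸ Submodule.subset_span hg
    induction f using MvPolynomial.induction_on' with
    | add p q hp hq =>
      rw [add_smul, DirectSum.decompose_add, DirectSum.add_apply, Submodule.coe_add, hp, hq,
        add_zero]
    | monomial m c =>
      by_cases hx : ∀ a, m (Sum.inl a) = 0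
      · refine stmt4_monomial_comp 𝒟 hgr (Finsupp.weight (stmt4Weight r s) m) t _
          (MvPolynomial.isWeightedHomogeneous_monomial _ _ _ rfl) g ?_
        intro q hq
        by_contra hne
        have := (hN' g hg q hne).1
        have h3 := stmt4_weight_fst m hx
        rw [← hq, Prod.fst_add, h3] at h1
        omega
      · by_cases hy : ∀ b, m (Sum.inr b) = 0
        · refine stmt4_monomial_comp 𝒟 hgr (Finsupp.weight (stmt4Weight r s) m) t _
            (MvPolynomial.isWeightedHomogeneous_monomial _ _ _ rfl) g ?_
          intro q hq
          by_contra hne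
          have := (hN' g hg q hne).2
          have h3 := stmt4_weight_snd m hy
          rw [← hq, Prod.snd_add, h3] at h2
          omega
        · push Not at hx hy
          obtain ⟨a, ha⟩ := hx
          obtain ⟨b, hb⟩ := hy
          obtain ⟨u, hu⟩ := stmt4_dvd (A := A) m c a b ha hb
          have h0 : (MvPolynomial.monomial m c : R) • g = 0 := by
            rw [hu, mul_comm, mul_smul]
            have := (hK g).1 hgK a b
            simp only [xy] at this
            rw [this, smul_zero]
          rw [h0, DirectSum.decompose_zero]; rfl
  have hall : ∀ d ∈ K, ∀ f : R, ∀ t : ℕ × ℕ, N.1 < t.1 → N.2 < t.2 →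
      (DirectSum.decompose 𝒟 (f • d) t : D) = 0 := by
    intro d hd
    rw [← hG] at hd
    induction hd using Submodule.span_induction with
    | mem g hg => exact hgen g hg
    | zero => intro f t _ _; rw [smul_zero, DirectSum.decompose_zero]; rfl
    | add x y _ _ hx hy =>
      intro f t h1 h2
      rw [smul_add, DirectSum.decompose_add, DirectSum.add_apply, Submodule.coe_add,
        hx f t h1 h2, hy f t h1 h2, add_zero]
    | smul c x _ hx =>
      intro f t h1 h2
      rw [← mul_smul]; exact hx _ t h1 h2
  refine ⟨N.1 + 1, N.2 + 1, fun i hi j hj => ?_⟩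
  have hmem : ∀ a b, ∀ d ∈ 𝒟 (i, j), xy a b • d ∈ 𝒟 (i + 1, j + 2) := by
    intro a b d hd
    have := hgr (1, 2) (i, j) _ (stmt4_XY a b) d hd
    rwa [Prod.mk_add_mk, add_comm 1 i, add_comm 2 j] at this
  refine ⟨LinearMap.pi fun k => (Algebra.lsmul A A D
    (xy (finProdFinEquiv.symm k).1 (finProdFinEquiv.symm k).2)).restrict
      (hmem _ _), ?_⟩
  rw [← LinearMap.ker_eq_bot, LinearMap.ker_eq_bot']
  intro d hd
  have hdK : (d : D) ∈ K := by
    rw [hK]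
    intro a b
    have := congrArg Subtype.val (congrFun hd (finProdFinEquiv (a, b)))
    have h2 : xy (finProdFinEquiv.symm (finProdFinEquiv (a, b))).1
        (finProdFinEquiv.symm (finProdFinEquiv (a, b))).2 • (d : D) = 0 := this
    rwa [Equiv.symm_apply_apply] at h2
  have := hall d hdK 1 (i, j) hi hj
  rw [one_smul, DirectSum.decompose_of_mem_same 𝒟 d.2] at this
  exact Subtype.ext this
end

section
/- Let A be a commutative Noetherian ring and let R = A[x_1,…,x_r; y_1,…,y_s] be the bigraded polynomial ring over A with deg x_i = (2,0) for each i and deg y_j = (0,1) for each j. Let M = ⊕_{i,n≥0} M_{(i,n)} be a finitely generated bigraded R-module. Then: (1) the union ⋃_{i≥0} ⋃_{n≥0} Ass_A M_{(i,n)} is a finite set; (2) there exist i_0, n_0 such that for all i ≥ i_0 and n ≥ n_0 one has Ass_A M_{(2i,n)} = Ass_A M_{(2i_0,n_0)} and Ass_A M_{(2i+1,n)} = Ass_A M_{(2i_0+1,n_0)}. -/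
/-- The weight function making `A[x_1,…,x_r; y_1,…,y_s]` bigraded with
`deg xᵢ = (2,0)` and `deg yⱼ = (0,1)`. -/
def stmt5Weight (r s : ℕ) : Fin r ⊕ Fin s → ℕ × ℕ :=
  Sum.elim (fun _ => (2, 0)) (fun _ => (0, 1))

open DirectSum in
lemma s5_comp_smul {A : Type} [CommRing A] {r s : ℕ}
    {M : Type} [AddCommGroup M] [Module A M]
    [Module (MvPolynomial (Fin r ⊕ Fin s) A) M]
    (ℳ : ℕ × ℕ → Submodule A M) [DirectSum.Decomposition ℳ]
    (hgr : ∀ (p q : ℕ × ℕ),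
      ∀ f ∈ MvPolynomial.weightedHomogeneousSubmodule A (stmt5Weight r s) p,
      ∀ x ∈ ℳ q, f • x ∈ ℳ (p + q))
    (p q : ℕ × ℕ) (f : MvPolynomial (Fin r ⊕ Fin s) A)
    (hf : f ∈ MvPolynomial.weightedHomogeneousSubmodule A (stmt5Weight r s) p) (z : M) :
    (decompose ℳ (f • z) (p + q) : M) = f • (decompose ℳ z q : M) := by
  induction z using DirectSum.Decomposition.inductionOn ℳ with
  | zero => simp
  | @homogeneous q' m =>
    have hm := hgr p q' f hf m m.2
    by_cases h : q' = q
    · subst h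
      rw [decompose_of_mem_same ℳ hm, decompose_of_mem_same ℳ m.2]
    · rw [decompose_of_mem_ne ℳ hm (by simpa using h), decompose_of_mem_ne ℳ m.2 h, smul_zero]
  | add a b ha hb => simp [smul_add, decompose_add, ha, hb]

open DirectSum in
lemma s5_comp_smul_zero {A : Type} [CommRing A] {r s : ℕ}
    {M : Type} [AddCommGroup M] [Module A M]
    [Module (MvPolynomial (Fin r ⊕ Fin s) A) M]
    (ℳ : ℕ × ℕ → Submodule A M) [DirectSum.Decomposition ℳ]
    (hgr : ∀ (p q : ℕ × ℕ),
      ∀ f ∈ MvPolynomial.weightedHomogeneousSubmodule A (stmt5Weight r s) p,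
      ∀ x ∈ ℳ q, f • x ∈ ℳ (p + q))
    (p q : ℕ × ℕ) (f : MvPolynomial (Fin r ⊕ Fin s) A)
    (hf : f ∈ MvPolynomial.weightedHomogeneousSubmodule A (stmt5Weight r s) p) (z : M)
    (h : ∀ q', p + q' = q → (decompose ℳ z q' : M) = 0) :
    (decompose ℳ (f • z) q : M) = 0 := by
  by_cases hq : ∃ q', p + q' = q
  · obtain ⟨q', rfl⟩ := hq
    rw [s5_comp_smul ℳ hgr p q' f hf, h q' rfl, smul_zero]
  · push Not at hq
    clear h
    induction z using DirectSum.Decomposition.inductionOn ℳ with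
    | zero => simp
    | @homogeneous q' m =>
      exact decompose_of_mem_ne ℳ (hgr p q' f hf m m.2) (hq q')
    | add a b ha hb => simp [smul_add, decompose_add, ha, hb]

lemma s5_ass_iff {A : Type} [CommRing A] [IsNoetherianRing A] {M : Type} [AddCommGroup M]
    [Module A M] (P : Ideal A) :
    P ∈ associatedPrimes A M ↔ P.IsPrime ∧ ∃ y : M, ∀ a : A, a ∈ P ↔ a • y = 0 := by
  rw [AssociatedPrimes.mem_iff, isAssociatedPrime_iff]
  simp [SetLike.ext_iff, Submodule.mem_colon_singleton]

/-- contraction -/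
lemma s5_contract {A R M : Type} [CommRing A] [CommRing R] [IsNoetherianRing R] [Algebra A R]
    [AddCommGroup M] [Module A M] [Module R M] [IsScalarTower A R M]
    (P : Ideal A) (hP : P.IsPrime) (x : M) (hx : ∀ a : A, a ∈ P ↔ a • x = 0) :
    ∃ Q ∈ associatedPrimes R M, Ideal.comap (algebraMap A R) Q = P := by
  let F : Set (Ideal R) := {I | ∃ y : M, (∀ f : R, f ∈ I ↔ f • y = 0) ∧
    ∀ a : A, a ∈ P ↔ algebraMap A R a • y = 0}
  have hF : F.Nonempty := by
    refine ⟨(⊥ : Submodule R M).colon {x}, x, ?_, ?_⟩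
    · intro f; simp [Submodule.mem_colon_singleton]
    · intro a; rw [hx, algebraMap_smul]
  obtain ⟨Q, ⟨y, hQ, hyP⟩, hmax⟩ := set_has_maximal_iff_noetherian.mpr ‹IsNoetherianRing R› F hF
  have key : ∀ f : R, f • y ≠ 0 → ∀ g, g ∉ Q → g • f • y = 0 →
      ∃ a, a ∉ P ∧ algebraMap A R a • f • y = 0 := by
    intro f hf g hg hgf
    by_contra! hcon
    refine hmax ((⊥ : Submodule R M).colon {f • y}) ⟨f • y, ?_, ?_⟩ ?_
    · intro f; simp [Submodule.mem_colon_singleton]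
    · intro a
      constructor
      · intro ha
        rw [smul_comm, (hyP a).1 ha, smul_zero]
      · intro ha
        by_contra h
        exact hcon a h ha
    · refine lt_of_le_of_ne ?_ ?_
      · intro h hh
        rw [Submodule.mem_colon_singleton, smul_comm, (hQ h).1 hh, smul_zero]
        exact Submodule.zero_mem _
      · rintro rfl
        exact hg (by rw [Submodule.mem_colon_singleton, hgf]; exact Submodule.zero_mem _)
  have hQP : Ideal.comap (algebraMap A R) Q = P := by
    ext a; rw [Ideal.mem_comap, hQ, hyP]
  refine ⟨Q, (s5_ass_iff Q).2 ⟨⟨?_, ?_⟩, y, hQ⟩, hQP⟩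
  · rintro rfl
    exact hP.ne_top (by rw [← hQP]; rfl)
  · intro f g hfg
    by_contra! hc
    obtain ⟨hf, hg⟩ := hc
    obtain ⟨a, ha, h1⟩ := key f (fun h => hf ((hQ f).2 h)) g hg
      (by rw [smul_smul, mul_comm]; exact (hQ _).1 hfg)
    obtain ⟨b, hb, h2⟩ := key (algebraMap A R a) (fun h => ha ((hyP a).2 h)) f hf
      (by rw [smul_comm]; exact h1)
    have : b * a ∈ P := by rw [hyP, map_mul, mul_smul]; exact h2
    rcases hP.mem_or_mem this with h | h
    · exact hb h
    · exact ha h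

lemma s5_weight_x {r s : ℕ} (d : Fin r ⊕ Fin s →₀ ℕ) (h : ∀ j, d (Sum.inl j) = 0) :
    (Finsupp.weight (stmt5Weight r s) d).1 = 0 := by
  rw [Finsupp.weight_apply, Finsupp.sum_fintype _ _ (by simp)]
  simp [Prod.fst_sum, stmt5Weight, h]

lemma s5_weight_y {r s : ℕ} (d : Fin r ⊕ Fin s →₀ ℕ) (h : ∀ j, d (Sum.inr j) = 0) :
    (Finsupp.weight (stmt5Weight r s) d).2 = 0 := by
  rw [Finsupp.weight_apply, Finsupp.sum_fintype _ _ (by simp)]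
  simp [Prod.snd_sum, stmt5Weight, h]

open DirectSum in
lemma s5_step (A : Type) [CommRing A] [IsNoetherianRing A] (r s : ℕ)
    (M : Type) [AddCommGroup M] [Module A M]
    [Module (MvPolynomial (Fin r ⊕ Fin s) A) M]
    [IsScalarTower A (MvPolynomial (Fin r ⊕ Fin s) A) M]
    [Module.Finite (MvPolynomial (Fin r ⊕ Fin s) A) M]
    (ℳ : ℕ × ℕ → Submodule A M) [DirectSum.Decomposition ℳ]
    (hgr : ∀ (p q : ℕ × ℕ),
      ∀ f ∈ MvPolynomial.weightedHomogeneousSubmodule A (stmt5Weight r s) p,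
      ∀ x ∈ ℳ q, f • x ∈ ℳ (p + q)) (P : Ideal A) (hP : P.IsPrime) :
    ∃ B : ℕ, ∀ q : ℕ × ℕ, P ∉ associatedPrimes A (ℳ q) →
      (B ≤ q.1 → P ∉ associatedPrimes A (ℳ ((2, 0) + q))) ∧
      (B ≤ q.2 → P ∉ associatedPrimes A (ℳ ((0, 1) + q))) := by
  classical
  let R := MvPolynomial (Fin r ⊕ Fin s) A
  let N : Submodule R M :=
    { carrier := {y | ∀ a ∈ P, a • y = 0}
      add_mem' := by intro x y hx hy a ha; rw [smul_add, hx a ha, hy a ha, add_zero]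
      zero_mem' := by intro a _; exact smul_zero a
      smul_mem' := by intro f x hx a ha; rw [smul_comm, hx a ha, smul_zero] }
  let T : Submodule R M :=
    { carrier := {y | ∃ a, a ∉ P ∧ a • y = 0}
      add_mem' := by
        rintro x y ⟨a, ha, hx⟩ ⟨b, hb, hy⟩
        refine ⟨a * b, fun h => (hP.mem_or_mem h).elim ha hb, ?_⟩
        rw [smul_add, mul_smul a b y, hy, mul_comm, mul_smul, hx, smul_zero, smul_zero, add_zero]
      zero_mem' := ⟨1, fun h => hP.ne_top ((Ideal.eq_top_iff_one _).2 h), smul_zero _⟩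
      smul_mem' := by
        rintro f x ⟨a, ha, hx⟩
        exact ⟨a, ha, by rw [smul_comm, hx, smul_zero]⟩ }
  have hT : ∀ q, P ∉ associatedPrimes A (ℳ q) ↔ ∀ y ∈ N, y ∈ ℳ q → y ∈ T := by
    intro q
    rw [s5_ass_iff]
    constructor
    · intro h y hy hyq
      by_contra hyT
      refine h ⟨hP, ⟨y, hyq⟩, fun a => ⟨fun ha => Subtype.ext (hy a ha), fun ha => ?_⟩⟩
      by_contra haP
      exact hyT ⟨a, haP, congrArg Subtype.val ha⟩
    · rintro h ⟨-, ⟨y, hyq⟩, hy⟩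
      obtain ⟨a, ha, hay⟩ := h y (fun a ha => congrArg Subtype.val ((hy a).1 ha)) hyq
      exact ha ((hy a).2 (Subtype.ext hay))
  have hNc : ∀ y ∈ N, ∀ q, (decompose ℳ y q : M) ∈ N := by
    intro y hy q a ha
    have : decompose ℳ (a • y) = a • decompose ℳ y := decompose_smul ℳ a y
    have h2 := congrArg (fun t => (t q : M)) this
    simp only [hy a ha] at h2
    have h3 : ((a • decompose ℳ y) q : M) = a • (decompose ℳ y q : M) := rfl
    rw [← h3, ← h2, decompose_zero]
    rfl
  have : IsNoetherian R M := isNoetherian_of_isNoetherianRing_of_finite R M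
  obtain ⟨G, hG⟩ := IsNoetherian.noetherian N
  obtain ⟨B, hB⟩ : ∃ B : ℕ, ∀ g ∈ G, ∀ q' : ℕ × ℕ, B < q'.1 ∨ B < q'.2 →
      (decompose ℳ g q' : M) = 0 := by
    let U := G.biUnion fun g => (decompose ℳ g).support
    refine ⟨U.sup Prod.fst + U.sup Prod.snd, fun g hg q' hq' => ?_⟩
    by_contra hne
    have hU : q' ∈ U := by
      simp only [U, Finset.mem_biUnion, DFinsupp.mem_support_iff]
      exact ⟨g, hg, fun h => hne (by rw [h]; rfl)⟩
    have h1 := Finset.le_sup (f := Prod.fst) hU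
    have h2 := Finset.le_sup (f := Prod.snd) hU
    omega
  -- general step
  have gen : ∀ (u q : ℕ × ℕ), (∀ y ∈ N, y ∈ ℳ q → y ∈ T) →
      (∀ d : Fin r ⊕ Fin s →₀ ℕ, (∀ v, stmt5Weight r s v = u → d v = 0) →
        ∀ q', Finsupp.weight (stmt5Weight r s) d + q' = u + q → B < q'.1 ∨ B < q'.2) →
      (∀ y ∈ N, y ∈ ℳ (u + q) → y ∈ T) := by
    intro u q hq hd y hy hyq
    have main : ∀ f : R, (decompose ℳ (f • y) (u + q) : M) ∈ T := by
      clear hyq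
      rw [← hG] at hy
      induction hy using Submodule.span_induction with
      | zero => intro f; simp
      | add a b _ _ ha hb =>
        intro f
        simp only [smul_add, decompose_add]
        exact T.add_mem (ha f) (hb f)
      | smul c a _ ha => intro f; rw [smul_smul]; exact ha _
      | mem g hg =>
        intro f
        have hgN : g ∈ N := by rw [← hG]; exact Submodule.subset_span hg
        induction f using MvPolynomial.induction_on' with
        | add a b ha hb =>
          simp only [add_smul, decompose_add]
          exact T.add_mem ha hb
        | monomial d c =>
          by_cases h : ∀ v, stmt5Weight r s v = u → d v = 0
          · rw [s5_comp_smul_zero ℳ hgr (Finsupp.weight (stmt5Weight r s) d) (u + q)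
              (MvPolynomial.monomial d c)
              (MvPolynomial.isWeightedHomogeneous_monomial _ _ _ rfl) g]
            · exact T.zero_mem
            · intro q' hq'
              exact hB g hg q' (hd d h q' hq')
          · push Not at h
            obtain ⟨v, hv, hdv⟩ := h
            have hm : MvPolynomial.monomial d c = MvPolynomial.X v *
                MvPolynomial.monomial (d - Finsupp.single v 1) c := by
              rw [MvPolynomial.X, MvPolynomial.monomial_mul, one_mul, add_tsub_cancel_of_le]
              simpa using Nat.one_le_iff_ne_zero.2 hdv
            rw [hm, mul_smul, s5_comp_smul ℳ hgr u q (MvPolynomial.X v)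
              (by rw [← hv]; exact MvPolynomial.isWeightedHomogeneous_X _ _ _)]
            exact T.smul_mem _ (hq _ (hNc _ (N.smul_mem _ hgN) _) (SetLike.coe_mem _))
    have := main 1
    rwa [one_smul, decompose_of_mem_same ℳ hyq] at this
  refine ⟨B, fun q hq => ⟨fun hBq => ?_, fun hBq => ?_⟩⟩
  · rw [hT] at hq ⊢
    refine gen (2, 0) q hq fun d hd q' hq' => Or.inl ?_
    have h0 := s5_weight_x d (fun j => hd _ rfl)
    have := congrArg Prod.fst hq'
    simp only [Prod.fst_add] at this
    omega
  · rw [hT] at hq ⊢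
    refine gen (0, 1) q hq fun d hd q' hq' => Or.inr ?_
    have h0 := s5_weight_y d (fun j => hd _ rfl)
    have := congrArg Prod.snd hq'
    simp only [Prod.snd_add] at this
    omega

lemma s5_stab (S : ℕ × ℕ → Prop) (B e : ℕ)
    (h : ∀ q, ¬ S q → (B ≤ q.1 → ¬ S ((2, 0) + q)) ∧ (B ≤ q.2 → ¬ S ((0, 1) + q))) :
    ∃ (b : Prop) (K : ℕ), ∀ i ≥ K, ∀ n ≥ K, (S (2 * i + e, n) ↔ b) := by
  by_cases hz : ∃ i n, B ≤ i ∧ B ≤ n ∧ ¬ S (2 * i + e, n)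
  · obtain ⟨i, n, hi, hn, hS⟩ := hz
    have h1 : ∀ k, ¬ S (2 * (i + k) + e, n) := by
      intro k
      induction k with
      | zero => exact hS
      | succ k ih =>
        have := (h _ ih).1 (by simp only; omega)
        convert this using 2
        simp only [Prod.mk_add_mk, Prod.mk.injEq]
        omega
    have h2 : ∀ k l, ¬ S (2 * (i + k) + e, n + l) := by
      intro k l
      induction l with
      | zero => exact h1 k
      | succ l ih =>
        have := (h _ ih).2 (by simp only; omega)
        convert this using 2
        simp only [Prod.mk_add_mk, Prod.mk.injEq]
        omega
    refine ⟨False, i + n, fun i' hi' n' hn' => ?_⟩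
    rw [iff_false]
    have := h2 (i' - i) (n' - n)
    rwa [Nat.add_sub_cancel' (by omega), Nat.add_sub_cancel' (by omega)] at this
  · push Not at hz
    exact ⟨True, B, fun i hi n hn => iff_true_intro (hz i n hi hn)⟩

/-- Let `A` be Noetherian and `R = A[x_1,…,x_r; y_1,…,y_s]` the bigraded
polynomial ring with `deg xᵢ = (2,0)`, `deg yⱼ = (0,1)`.  If `M = ⊕ M_{(i,n)}` is a finitely
generated bigraded `R`-module then (1) `⋃_{i,n} Ass_A M_{(i,n)}` is finite, and (2) there are
`i₀, n₀` such that for all `i ≥ i₀`, `n ≥ n₀`,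
`Ass_A M_{(2i,n)} = Ass_A M_{(2i₀,n₀)}` and `Ass_A M_{(2i+1,n)} = Ass_A M_{(2i₀+1,n₀)}`. -/
theorem stmt5 (A : Type) [CommRing A] [IsNoetherianRing A] (r s : ℕ)
    (M : Type) [AddCommGroup M] [Module A M]
    [Module (MvPolynomial (Fin r ⊕ Fin s) A) M]
    [IsScalarTower A (MvPolynomial (Fin r ⊕ Fin s) A) M]
    [Module.Finite (MvPolynomial (Fin r ⊕ Fin s) A) M]
    (ℳ : ℕ × ℕ → Submodule A M) [DirectSum.Decomposition ℳ]
    (hgr : ∀ (p q : ℕ × ℕ),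
      ∀ f ∈ MvPolynomial.weightedHomogeneousSubmodule A (stmt5Weight r s) p,
      ∀ x ∈ ℳ q, f • x ∈ ℳ (p + q)) :
    (⋃ i : ℕ, ⋃ n : ℕ, associatedPrimes A (ℳ (i, n))).Finite ∧
    ∃ i₀ n₀ : ℕ, ∀ i ≥ i₀, ∀ n ≥ n₀,
      associatedPrimes A (ℳ (2 * i, n)) = associatedPrimes A (ℳ (2 * i₀, n₀)) ∧
      associatedPrimes A (ℳ (2 * i + 1, n)) = associatedPrimes A (ℳ (2 * i₀ + 1, n₀)) := by
  classical
  have hfin : (⋃ i : ℕ, ⋃ n : ℕ, associatedPrimes A (ℳ (i, n))).Finite := by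
    refine ((associatedPrimes.finite (MvPolynomial (Fin r ⊕ Fin s) A) M).image
      (fun Q => Q.comap (algebraMap A (MvPolynomial (Fin r ⊕ Fin s) A)))).subset ?_
    intro P hP
    simp only [Set.mem_iUnion] at hP
    obtain ⟨i, n, hP⟩ := hP
    have hP' := associatedPrimes.subset_of_injective (ℳ (i, n)).injective_subtype hP
    obtain ⟨hp, x, hx⟩ := (s5_ass_iff P).1 hP'
    exact s5_contract P hp x hx
  refine ⟨hfin, ?_⟩
  have key : ∀ (e : ℕ) (P : Ideal A), ∃ (b : Prop) (K : ℕ), ∀ i ≥ K, ∀ n ≥ K,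
      (P ∈ associatedPrimes A (ℳ (2 * i + e, n)) ↔ b) := by
    intro e P
    by_cases hP : P.IsPrime
    · obtain ⟨B, hB⟩ := s5_step A r s M ℳ hgr P hP
      exact s5_stab (fun q => P ∈ associatedPrimes A (ℳ q)) B e hB
    · exact ⟨False, 0, fun i _ n _ => iff_false_intro fun h => hP h.1⟩
  choose b K hK using key
  let F := hfin.toFinset
  let L := F.sup (K 0) + F.sup (K 1)
  have fin : ∀ e, e = 0 ∨ e = 1 → ∀ i ≥ L, ∀ n ≥ L,
      associatedPrimes A (ℳ (2 * i + e, n)) = associatedPrimes A (ℳ (2 * L + e, L)) := by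
    intro e he i hi n hn
    ext P
    by_cases hPF : P ∈ F
    · have hL : K e P ≤ L := by
        have h0 := Finset.le_sup (f := K 0) hPF
        have h1 := Finset.le_sup (f := K 1) hPF
        rcases he with rfl | rfl <;> simp only [L] <;> omega
      rw [hK e P i (hL.trans hi) n (hL.trans hn), hK e P L hL L hL]
    · have : ∀ i n, P ∉ associatedPrimes A (ℳ (i, n)) := by
        intro i n h
        apply hPF
        simp only [F, Set.Finite.mem_toFinset, Set.mem_iUnion]
        exact ⟨i, n, h⟩
      exact iff_of_false (this _ _) (this _ _)
  exact ⟨L, L, fun i hi n hn => ⟨fin 0 (Or.inl rfl) i hi n hn, fin 1 (Or.inr rfl) i hi n hn⟩⟩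
end

section
/- Let Q be a commutative Noetherian ring of finite Krull dimension, let f_1,…,f_c be a regular sequence in Q, and set A = Q/(f_1,…,f_c). Let M be a finitely generated A-module whose projective dimension over Q (via the quotient map Q → A) is finite. Let I be an ideal of A and D a finitely generated A-module. Then the union ⋃_{n≥0} ⋃_{i≥0} Ass_A Ext^i_A(M, I^n D) is a finite set. -/
open CategoryTheory

/-- The `i`-th Ext module `Ext^i_A(M, N)` of `A`-modules, as a type. -/
noncomputable abbrev extAP (A : Type) [CommRing A] (M N : Type) [AddCommGroup M] [Module A M]
    [AddCommGroup N] [Module A N] (i : ℕ) : Type :=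
  ((Ext A (ModuleCat A) i).obj (Opposite.op (ModuleCat.of A M))).obj (ModuleCat.of A N)

namespace S6

/-- A finite graded resolution, with the grading given by projections. -/
structure GRes (Q M : Type) [CommRing Q] [AddCommGroup M] [Module Q M] where
  G : Type
  [acg : AddCommGroup G]
  [mod : Module Q G]
  [fin : Module.Finite Q G]
  [proj : Module.Projective Q G]
  n : ℕ
  p : ℤ → Module.End Q G
  d : Module.End Q G
  ε : G →ₗ[Q] M
  p_idem : ∀ i x, p i (p i x) = p i x
  p_orth : ∀ i j x, i ≠ j → p i (p j x) = 0
  p_sum : ∀ x, ∑ i ∈ Finset.range (n + 1), p i x = x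
  p_d : ∀ i x, p i (d x) = d (p (i + 1) x)
  d_d : ∀ x, d (d x) = 0
  ε_d : ∀ x, ε (d x) = 0
  ε_p : ∀ i x, i ≠ 0 → ε (p i x) = 0
  ε_surj : Function.Surjective ε
  exact : ∀ i x, 0 < i → p i x = x → d x = 0 → ∃ y, p (i + 1) y = y ∧ d y = x
  exact0 : ∀ x, p 0 x = x → ε x = 0 → ∃ y, p 1 y = y ∧ d y = x

attribute [instance] GRes.acg GRes.mod GRes.fin GRes.proj

def GRes.ofProj (Q M : Type) [CommRing Q] [AddCommGroup M] [Module Q M] [Module.Finite Q M]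
    [Module.Projective Q M] : GRes Q M where
  G := M
  n := 0
  p i := if i = 0 then LinearMap.id else 0
  d := 0
  ε := LinearMap.id
  p_idem i x := by split_ifs <;> simp
  p_orth i j x h := by
    by_cases hi : i = 0
    · have : j ≠ 0 := fun h' => h (hi.trans h'.symm)
      simp [this]
    · simp [hi]
  p_sum x := by simp
  p_d := by simp
  d_d := by simp
  ε_d := by simp
  ε_p i x h := by simp [h]
  ε_surj := fun x => ⟨x, rfl⟩
  exact i x hi h := by
    have : i ≠ 0 := by omega
    simp [this] at h
    exact fun _ => ⟨0, by rw [map_zero], by simp [h]⟩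
  exact0 x _ h := ⟨0, by simpa using h.symm⟩

variable {Q : Type} [CommRing Q]

lemma GRes.p_neg {M : Type} [AddCommGroup M] [Module Q M] (R : GRes Q M) (i : ℤ)
    (hi : i < 0 ∨ (R.n : ℤ) < i) (x : R.G) : R.p i x = 0 := by
  rw [← R.p_sum x, map_sum]
  refine Finset.sum_eq_zero fun j hj => R.p_orth _ _ _ ?_
  rw [Finset.mem_range] at hj
  omega

noncomputable def GRes.cons {M P K : Type} [AddCommGroup M] [Module Q M] [AddCommGroup P] [Module Q P]
    [Module.Finite Q P] [Module.Projective Q P] [AddCommGroup K] [Module Q K]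
    (g : P →ₗ[Q] M) (hg : Function.Surjective g) (k : K →ₗ[Q] P) (hk : Function.Injective k)
    (hex : Function.Exact k g) (R : GRes Q K) : GRes Q M where
  G := P × R.G
  n := R.n + 1
  p i := LinearMap.prodMap (if i = 0 then LinearMap.id else 0) (R.p (i - 1))
  d := LinearMap.prod (k ∘ₗ R.ε ∘ₗ LinearMap.snd Q P R.G) (R.d ∘ₗ LinearMap.snd Q P R.G)
  ε := g ∘ₗ LinearMap.fst Q P R.G
  p_idem i x := by
    ext
    · simp; split_ifs <;> simp
    · simp [R.p_idem]
  p_orth i j x h := by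
    ext
    · by_cases hi : i = 0
      · have : j ≠ 0 := fun h' => h (hi.trans h'.symm)
        simp [this]
      · simp [hi]
    · simp only [LinearMap.prodMap_apply]
      exact R.p_orth _ _ _ (by omega)
  p_sum x := by
    rw [Finset.sum_range_succ']
    ext
    · simp [Prod.fst_sum]
      refine Finset.sum_eq_zero fun j _ => ?_
      rw [if_neg (by omega)]; rfl
    · simp [Prod.snd_sum, R.p_sum, R.p_neg (-1) (by omega)]
  p_d i x := by
    ext
    · by_cases hi : i = 0
      · subst hi
        simp
        conv_lhs => rw [← R.p_sum x.2]
        rw [map_sum, Finset.sum_eq_single_of_mem 0 (by simp) (fun j _ hj => R.ε_p _ _ (by omega))]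
        simp
      · simp [hi]
        rw [R.ε_p _ _ hi]; simp
    · simp [R.p_d]
  d_d x := by simp [R.d_d, R.ε_d]
  ε_d x := by
    simp only [LinearMap.comp_apply, LinearMap.prod_apply, LinearMap.fst_apply]
    exact hex.apply_apply_eq_zero _
  ε_p i x h := by simp [h]
  ε_surj x := by
    obtain ⟨y, rfl⟩ := hg x
    exact ⟨(y, 0), rfl⟩
  exact i x hi h hd := by
    have hi' : i ≠ 0 := by omega
    obtain ⟨x1, x2⟩ := x
    simp [hi'] at h
    simp at hd
    obtain ⟨rfl, h⟩ := h
    by_cases h1 : i = 1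
    · subst h1
      obtain ⟨y, hy, hyd⟩ := R.exact0 x2 (by simpa using h) (hk (by simp [hd.1]))
      refine ⟨(0, y), ?_, ?_⟩
      · simp [hy]
      · have : R.ε y = 0 := by rw [← hy]; exact R.ε_p _ _ (by omega)
        simp [hyd, this]
    · obtain ⟨y, hy, hyd⟩ := R.exact (i - 1) x2 (by omega) h hd.2
      refine ⟨(0, y), ?_, ?_⟩
      · have : i + 1 - 1 = i - 1 + 1 := by ring
        simp only [LinearMap.prodMap_apply, this, hy, map_zero]
      · have : R.ε y = 0 := by rw [← hy]; exact R.ε_p _ _ (by omega)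
        simp [hyd, this]
  exact0 x h hx := by
    obtain ⟨x1, x2⟩ := x
    simp at h hx
    have h2 : x2 = 0 := by rw [← h, R.p_neg _ (by omega)]
    subst h2
    obtain ⟨z, rfl⟩ := (hex x1).1 hx
    obtain ⟨w, rfl⟩ := R.ε_surj z
    refine ⟨(0, R.p 0 w), ?_, ?_⟩
    · simp [R.p_idem]
    · have h1 : R.ε (R.p 0 w) = R.ε w := by
        conv_rhs => rw [← R.p_sum w]
        rw [map_sum, Finset.sum_eq_single_of_mem 0 (by simp) (fun j _ hj => R.ε_p _ _ (by omega))]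
        simp
      have h2 : R.d (R.p 0 w) = 0 := by
        have := R.p_d (-1) w
        rw [R.p_neg _ (by omega)] at this
        simpa using this.symm
      simp [h1, h2]

theorem GRes.exists_of_pd [IsNoetherianRing Q] (n : ℕ) : ∀ (M : Type) [AddCommGroup M] [Module Q M]
    [Module.Finite Q M], HasProjectiveDimensionLE (ModuleCat.of Q M) n → Nonempty (GRes Q M) := by
  induction n with
  | zero =>
    intro M _ _ _ h
    have h' : Projective (ModuleCat.of Q M) := projective_iff_hasProjectiveDimensionLT_one.2 h
    rw [← IsProjective.iff_projective] at h'
    exact ⟨GRes.ofProj Q M⟩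
  | succ n ih =>
    intro M _ _ _ h
    obtain ⟨r, g, hg⟩ := Module.Finite.exists_fin' Q M
    let S : ShortComplex (ModuleCat Q) := ShortComplex.mk
      (ModuleCat.ofHom (LinearMap.ker g).subtype) (ModuleCat.ofHom g) (by ext x; simp)
    have hS : S.ShortExact :=
      { exact := by
          rw [ShortComplex.ShortExact.moduleCat_exact_iff_function_exact]
          exact LinearMap.exact_subtype_ker_map g
        mono_f := (ModuleCat.mono_iff_injective _).2 (LinearMap.ker g).injective_subtype
        epi_g := (ModuleCat.epi_iff_surjective _).2 hg }
    have hp : Projective S.X₂ := by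
      change Projective (ModuleCat.of Q (Fin r → Q))
      rw [← IsProjective.iff_projective]; infer_instance
    have := (hS.hasProjectiveDimensionLT_X₃_iff n hp).1 h
    obtain ⟨R⟩ := ih (LinearMap.ker g) this
    exact ⟨GRes.cons g hg _ (LinearMap.ker g).injective_subtype (LinearMap.exact_subtype_ker_map g) R⟩

end S6

namespace S6
variable {Q : Type} [CommRing Q]

lemma pd_step {X M K : Type} [AddCommGroup X] [Module Q X] [AddCommGroup M] [Module Q M]
    [AddCommGroup K] [Module Q K]
    [Module.Projective Q X] (k : K →ₗ[Q] X) (hk : Function.Injective k)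
    (g : X →ₗ[Q] M) (hg : Function.Surjective g) (h : Function.Exact k g) (m : ℕ)
    (hm : HasProjectiveDimensionLT (ModuleCat.of Q K) (m + 1)) :
    HasProjectiveDimensionLT (ModuleCat.of Q M) (m + 2) := by
  let S : ShortComplex (ModuleCat Q) := ShortComplex.mk
      (ModuleCat.ofHom k) (ModuleCat.ofHom g) (by
        ext x; simpa using h.apply_apply_eq_zero x)
  have hS : S.ShortExact :=
      { exact := by
          rw [ShortComplex.ShortExact.moduleCat_exact_iff_function_exact]
          exact h
        mono_f := (ModuleCat.mono_iff_injective _).2 hk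
        epi_g := (ModuleCat.epi_iff_surjective _).2 hg }
  have hp : Projective S.X₂ := by
      change Projective (ModuleCat.of Q X)
      rw [← IsProjective.iff_projective]; infer_instance
  exact (hS.hasProjectiveDimensionLT_X₃_iff m hp).2 hm

/-- elementwise consequence of vanishing of Ext -/
lemma ext_vanish {M : ModuleCat.{0} Q} (R : ProjectiveResolution M) (L : ModuleCat.{0} Q) (n : ℕ)
    (h : Subsingleton (((Ext Q (ModuleCat Q) (n + 1)).obj (Opposite.op M)).obj L))
    (φ : R.complex.X (n + 1) ⟶ L) (hφ : R.complex.d (n + 2) (n + 1) ≫ φ = 0) :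
    ∃ ψ : R.complex.X n ⟶ L, R.complex.d (n + 1) n ≫ ψ = φ := by
  have h1 : Limits.IsZero ((R.complex.linearYonedaObj Q L).homology (n + 1)) :=
    (ModuleCat.isZero_of_subsingleton _).of_iso (R.isoExt (R := Q) (n + 1) L).symm
  rw [← HomologicalComplex.exactAt_iff_isZero_homology,
    HomologicalComplex.exactAt_iff' _ n (n+1) (n+2) (by simp) (by simp),
    ShortComplex.moduleCat_exact_iff] at h1
  obtain ⟨ψ, hψ⟩ := h1 φ (by exact hφ)
  exact ⟨ψ, hψ⟩

lemma res_exact {M : ModuleCat.{0} Q} (R : ProjectiveResolution M) (n : ℕ) :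
    Function.Exact (R.complex.d (n + 2) (n + 1)).hom (R.complex.d (n + 1) n).hom := by
  have := R.complex_exactAt_succ n
  rw [HomologicalComplex.exactAt_iff' _ (n+2) (n+1) n (by simp) (by simp),
    ShortComplex.ShortExact.moduleCat_exact_iff_function_exact] at this
  exact this

lemma res_exact0 {M : ModuleCat.{0} Q} (R : ProjectiveResolution M) :
    Function.Exact (R.complex.d 1 0).hom (R.π.f 0).hom := by
  have := R.exact₀
  rw [ShortComplex.ShortExact.moduleCat_exact_iff_function_exact] at this
  exact this

theorem pd_of_ext (M : Type) [AddCommGroup M] [Module Q M] (n : ℕ)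
    (h : ∀ (L : Type) [AddCommGroup L] [Module Q L],
      Subsingleton (((Ext Q (ModuleCat Q) (n + 1)).obj
        (Opposite.op (ModuleCat.of Q M))).obj (ModuleCat.of Q L))) :
    HasProjectiveDimensionLE (ModuleCat.of Q M) (n + 1) := by
  let R := ProjectiveResolution.of (ModuleCat.of Q M)
  have hpr : ∀ j, Module.Projective Q (R.complex.X j) := fun j => by
    rw [IsProjective.iff_projective]; exact R.projective j
  let r : ∀ j, Submodule Q (R.complex.X j) := fun j => LinearMap.range (R.complex.d (j + 1) j).hom
  have hdd : ∀ j x, (R.complex.d (j + 1) j).hom ((R.complex.d (j + 2) (j + 1)).hom x) = 0 := by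
    intro j x
    exact (res_exact R j).apply_apply_eq_zero x
  have base : HasProjectiveDimensionLT (ModuleCat.of Q (r n)) 1 := by
    rw [← projective_iff_hasProjectiveDimensionLT_one, ← IsProjective.iff_projective]
    obtain ⟨ψ, hψ⟩ := ext_vanish R (ModuleCat.of Q (r n)) n (h _)
      (ModuleCat.ofHom (R.complex.d (n + 1) n).hom.rangeRestrict) (by
        ext x
        have := hdd n x
        exact this)
    refine Module.Projective.of_split (r n).subtype ψ.hom ?_
    ext ⟨_, y, rfl⟩
    have := congrArg (fun f => f.hom y) hψ
    exact congrArg Subtype.val this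
  have step : ∀ m j, j + m = n → HasProjectiveDimensionLT (ModuleCat.of Q (r j)) (m + 1) := by
    intro m
    induction m with
    | zero => rintro j rfl; exact base
    | succ m ih =>
      intro j hj
      refine pd_step (r (j + 1)).subtype (r (j+1)).injective_subtype
        (R.complex.d (j + 1) j).hom.rangeRestrict (LinearMap.surjective_rangeRestrict _) ?_ m
        (ih (j + 1) (by omega))
      intro x
      rw [Subtype.ext_iff]
      refine (res_exact R j x).trans ?_
      simp [r]
  refine pd_step (r 0).subtype (r 0).injective_subtype (R.π.f 0).hom ?_ ?_ n (step n 0 (by omega))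
  · have : Epi (R.π.f 0) := inferInstance
    exact (ModuleCat.epi_iff_surjective _).1 this
  · intro x
    refine (res_exact0 R x).trans ?_
    simp [r]

end S6

namespace S6
variable {Q : Type} [CommRing Q]

lemma GRes.ext_p {M : Type} [AddCommGroup M] [Module Q M] (R : GRes Q M) {N : Type}
    [AddCommGroup N] [Module Q N]
    (φ ψ : R.G →ₗ[Q] N) (h : ∀ (i : ℤ) x, φ (R.p i x) = ψ (R.p i x)) : φ = ψ := by
  ext x
  rw [← R.p_sum x, map_sum, map_sum]
  exact Finset.sum_congr rfl fun i _ => h i x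

lemma homotopy {M : Type} [AddCommGroup M] [Module Q M] (R : GRes Q M)
    (φ : Module.End Q R.G) (k : ℕ) (hφ : ∀ i x, R.p (i + k) (φ x) = φ (R.p i x))
    (hd : ∀ x, R.d (φ x) = φ (R.d x)) (hε : k = 0 → ∀ x, R.ε (φ x) = 0) :
    ∃ h : Module.End Q R.G, (∀ i x, R.p (i + k + 1) (h x) = h (R.p i x)) ∧
      ∀ x, R.d (h x) + h (R.d x) = φ x := by
  have key : ∀ m : ℕ, ∃ h : Module.End Q R.G, (∀ i x, R.p (i + k + 1) (h x) = h (R.p i x)) ∧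
      ∀ i : ℤ, i < m → ∀ x, R.d (h (R.p i x)) + h (R.d (R.p i x)) = φ (R.p i x) := by
    intro m
    induction m with
    | zero =>
      refine ⟨0, by simp, fun i hi x => ?_⟩
      rw [R.p_neg i (Or.inl (by simpa using hi))]; simp
    | succ m ih =>
      obtain ⟨h, hh, hr⟩ := ih
      have dp : ∀ (i : ℤ) x, R.d (R.p i x) = R.p (i - 1) (R.d x) := fun i x => by
        rw [R.p_d]; simp
      let ψ : Module.End Q R.G := (φ - h ∘ₗ R.d) ∘ₗ R.p m
      have hψ : ∀ x, ψ x = φ (R.p m x) - h (R.d (R.p m x)) := fun x => rfl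
      have hψp : ∀ x, R.p (m + k) (ψ x) = ψ x := fun x => by
        have e1 : R.p (m + k) (h (R.d (R.p m x))) = h (R.d (R.p m x)) := by
          have := hh (m - 1) (R.d (R.p m x))
          rw [show (m : ℤ) - 1 + k + 1 = m + k by ring] at this
          rw [this, ← dp, R.p_idem]
        rw [hψ, map_sub, hφ, R.p_idem, e1]
      have hψr : ∀ x, ψ x ∈ LinearMap.range R.d := fun x => by
        rcases Nat.eq_zero_or_pos (m + k) with h0 | h0
        · obtain ⟨rfl, rfl⟩ : m = 0 ∧ k = 0 := by omega
          have e0 : ψ x = φ (R.p 0 x) := by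
            rw [hψ, dp, R.p_neg ((0 : ℕ) - 1) (Or.inl (by simp))]; simp
          obtain ⟨y, _, hy⟩ := R.exact0 (ψ x) (by simpa using hψp x) (by
            rw [e0]; exact hε rfl _)
          exact ⟨y, hy⟩
        · obtain ⟨y, _, hy⟩ := R.exact (m + k) (ψ x) (by exact_mod_cast h0) (hψp x) (by
            rw [hψ, map_sub, hd, dp]
            have := hr (m - 1) (by simp) (R.d x)
            rw [dp (m - 1), R.d_d, map_zero, map_zero, add_zero] at this
            rw [this, sub_self])
          exact ⟨y, hy⟩
      obtain ⟨q₀, hq₀⟩ := Module.projective_lifting_property R.d.rangeRestrict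
        (ψ.codRestrict (LinearMap.range R.d) hψr) (LinearMap.surjective_rangeRestrict _)
      have hq : ∀ x, R.d (q₀ x) = ψ x := fun x => by
        have := congrArg (fun f => (f x : R.G)) hq₀
        exact this
      have dq : ∀ x, R.d (R.p (m + k + 1) (q₀ (R.p m x))) = ψ x := fun x => by
        rw [← R.p_d, hq, hψp, hψ, hψ, R.p_idem]
      refine ⟨h ∘ₗ (LinearMap.id - R.p m) + R.p (m + k + 1) ∘ₗ q₀ ∘ₗ R.p m, ?_, ?_⟩
      · intro i x
        simp only [LinearMap.add_apply, LinearMap.comp_apply, LinearMap.sub_apply, LinearMap.id_apply,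
          map_add, hh, map_sub]
        by_cases him : i = m
        · subst him
          simp only [R.p_idem]
        · rw [R.p_orth _ _ _ him, R.p_orth _ _ _ (Ne.symm him), R.p_orth _ _ _ (by omega)]
          simp
      · intro i hi x
        have e2 : R.p m (R.d (R.p i x)) = 0 := by
          rw [dp]
          exact R.p_orth _ _ _ (by push_cast at hi; omega)
        simp only [LinearMap.add_apply, LinearMap.comp_apply, LinearMap.sub_apply, LinearMap.id_apply,
          map_add, map_sub, e2, map_zero, sub_zero, add_zero, dq]
        by_cases him : i = m
        · subst him
          rw [R.p_idem, hψ, R.p_idem]; abel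
        · have := hr i (by push_cast at hi; omega) x
          rw [R.p_orth _ _ _ (Ne.symm him), hψ, R.p_orth _ _ _ (Ne.symm him)]
          simpa using this
  obtain ⟨h, hh, hr⟩ := key (R.n + 1)
  refine ⟨h, hh, fun x => ?_⟩
  have : R.d ∘ₗ h + h ∘ₗ R.d = φ := by
    refine R.ext_p _ _ fun i y => ?_
    by_cases hi : i < (R.n + 1 : ℕ)
    · exact hr i hi y
    · rw [R.p_neg i (Or.inr (by push_cast at hi; omega))]; simp
  exact congrArg (fun f => f x) this

open MvPowerSeries in
lemma coeff_mul_low {S : Type} [Ring S] {c : ℕ} (σ τ : MvPowerSeries (Fin c) S) (a : Fin c →₀ ℕ)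
    (h : ∀ b : Fin c →₀ ℕ, b.degree < a.degree → coeff b τ = 0) :
    coeff a (σ * τ) = coeff 0 σ * coeff a τ ∧ coeff a (τ * σ) = coeff a τ * coeff 0 σ := by
  classical
  constructor
  · rw [coeff_mul, Finset.sum_eq_single (0, a)]
    · rintro ⟨b, b'⟩ hb hne
      rw [Finset.HasAntidiagonal.mem_antidiagonal] at hb
      simp only at hb ⊢
      subst hb
      rw [h b' _, mul_zero]
      have : b.degree ≠ 0 := fun h0 => hne (by
        have := (Finsupp.degree_eq_zero_iff b).1 h0
        simp [this])
      rw [map_add]; omega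
    · intro h; simp at h
  · rw [coeff_mul, Finset.sum_eq_single (a, 0)]
    · rintro ⟨b, b'⟩ hb hne
      rw [Finset.HasAntidiagonal.mem_antidiagonal] at hb
      simp only at hb ⊢
      subst hb
      rw [h b _, zero_mul]
      have : b'.degree ≠ 0 := fun h0 => hne (by
        have := (Finsupp.degree_eq_zero_iff b').1 h0
        simp [this])
      rw [map_add]; omega
    · intro h; simp at h

/-- the scalar `f_j` if `a = e_j` and `0` otherwise -/
noncomputable def ww {c : ℕ} (f : Fin c → Q) (a : Fin c →₀ ℕ) : Q :=
  open scoped Classical in ∑ j, if a = Finsupp.single j 1 then f j else 0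

lemma ww_eq_zero {c : ℕ} (f : Fin c → Q) (a : Fin c →₀ ℕ) (h : a.degree ≠ 1) : ww f a = 0 := by
  classical
  refine Finset.sum_eq_zero fun j _ => if_neg ?_
  rintro rfl
  simp at h

open MvPowerSeries in
theorem exists_sigma {M : Type} [AddCommGroup M] [Module Q M] (R : GRes Q M) {c : ℕ} (f : Fin c → Q)
    (hf : ∀ j (x : M), f j • x = 0) :
    ∃ (σ : (Fin c →₀ ℕ) → Module.End Q R.G) (m : ℕ), σ 0 = R.d ∧
      (∀ a i x, R.p (i + 2 * a.degree - 1) (σ a x) = σ a (R.p i x)) ∧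
      (∀ a x, ∑ b ∈ Finset.HasAntidiagonal.antidiagonal a, σ b.1 (σ b.2 x) = ww f a • x) ∧
      (∀ a, m < a.degree → σ a = 0) := by
  classical
  have Sdeg : ∀ σ : MvPowerSeries (Fin c) (Module.End Q R.G),
      (∀ a i x, R.p (i + 2 * a.degree - 1) (coeff a σ x) = coeff a σ (R.p i x)) →
      ∀ a i x, R.p (i + 2 * a.degree - 2) (coeff a (σ * σ) x) = coeff a (σ * σ) (R.p i x) := by
    intro σ h a i x
    rw [coeff_mul]
    simp only [LinearMap.sum_apply, map_sum, Module.End.mul_apply]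
    refine Finset.sum_congr rfl fun b hb => ?_
    rw [← h, ← h]
    rw [Finset.HasAntidiagonal.mem_antidiagonal] at hb
    rw [← hb]
    congr 2
    rw [map_add]; push_cast; ring
  let W : MvPowerSeries (Fin c) (Module.End Q R.G) := fun a => algebraMap Q _ (ww f a)
  have hW : ∀ a, coeff a W = algebraMap Q _ (ww f a) := fun a => rfl
  have hWc : ∀ σ, σ * W = W * σ := by
    intro σ
    ext1 a
    rw [coeff_mul, coeff_mul, Finsupp.sum_antidiagonal_swap a (fun b b' => coeff b σ * coeff b' W)]
    refine Finset.sum_congr rfl fun b _ => ?_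
    simp only [hW]
    exact (Algebra.commutes _ _).symm
  have key : ∀ m : ℕ, ∃ σ : MvPowerSeries (Fin c) (Module.End Q R.G), coeff 0 σ = R.d ∧
      (∀ a i x, R.p (i + 2 * a.degree - 1) (coeff a σ x) = coeff a σ (R.p i x)) ∧
      (∀ a : Fin c →₀ ℕ, a.degree ≤ m → coeff a (σ * σ) = coeff a W) ∧
      (∀ a : Fin c →₀ ℕ, m < a.degree → coeff a σ = 0) := by
    intro m
    induction m with
    | zero =>
      have hc : ∀ a : Fin c →₀ ℕ, 0 < a.degree → coeff a (C (σ := Fin c) R.d) = 0 := by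
        intro a ha
        rw [coeff_C, if_neg]
        rintro rfl
        simp at ha
      refine ⟨C R.d, by simp, ?_, ?_, hc⟩
      · intro a i x
        rcases Nat.eq_zero_or_pos a.degree with h0 | h0
        · obtain rfl := (Finsupp.degree_eq_zero_iff a).1 h0
          have := R.p_d (i - 1) x
          simpa using this
        · rw [hc a h0]; simp
      · intro a ha
        obtain rfl := (Finsupp.degree_eq_zero_iff a).1 (by omega)
        rw [hW, ww_eq_zero _ _ (by simp), ← map_mul]
        ext x
        simp [R.d_d]
    | succ m ih =>
      obtain ⟨σ, h0, hp, hS, hl⟩ := ih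
      let E := W - σ * σ
      have hE : ∀ a : Fin c →₀ ℕ, a.degree ≤ m → coeff a E = 0 := fun a ha => by
        simp only [E, map_sub]; rw [hS a ha, sub_self]
      have hEc : σ * E = E * σ := by
        simp only [E, mul_sub, sub_mul, hWc, mul_assoc]
      have hex : ∀ a : Fin c →₀ ℕ, a.degree = m + 1 → ∃ h : Module.End Q R.G,
          (∀ i x, R.p (i + 2 * a.degree - 1) (h x) = h (R.p i x)) ∧
          R.d * h + h * R.d = coeff a E := by
        intro a ha
        obtain ⟨h, hh1, hh2⟩ := homotopy R (coeff a E) (2 * m) (by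
          intro i x
          have e1 := Sdeg σ hp a i x
          rw [ha, show (i + 2 * ((m + 1 : ℕ) : ℤ) - 2) = i + (2 * m : ℕ) by push_cast; ring] at e1
          simp only [E, map_sub, LinearMap.sub_apply, e1, hW]
          congr 1
          rcases Nat.eq_zero_or_pos m with rfl | hm
          · simp
          · rw [ww_eq_zero _ _ (by omega)]; simp) (by
          have e1 := (coeff_mul_low σ E a (fun b hb => hE b (by omega)))
          have e2 := e1.1.symm.trans ((congrArg (coeff a) hEc).trans e1.2)
          rw [h0] at e2
          intro x
          exact congrArg (fun g => g x) e2) (by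
          intro hm x
          obtain rfl : m = 0 := by omega
          have e1 : coeff a (σ * σ) = 0 := by
            rw [coeff_mul]
            refine Finset.sum_eq_zero fun b hb => ?_
            rw [Finset.HasAntidiagonal.mem_antidiagonal] at hb
            have := congrArg Finsupp.degree hb
            rw [map_add] at this
            by_cases hb1 : 0 < b.1.degree
            · rw [hl _ hb1, zero_mul]
            · rw [hl b.2 (by omega), mul_zero]
          simp only [E, map_sub, e1, sub_zero, hW]
          rw [Module.algebraMap_end_apply, map_smul, ww, Finset.sum_smul]
          refine Finset.sum_eq_zero fun j _ => ?_
          split_ifs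
          · exact hf _ _
          · simp)
        refine ⟨h, fun i x => ?_, ?_⟩
        · rw [← hh1, ha]
          congr 2
          push_cast; ring
        · ext x; exact hh2 x
      choose h hh1 hh2 using hex
      let τ : MvPowerSeries (Fin c) (Module.End Q R.G) :=
        fun a => if ha : a.degree = m + 1 then h a ha else 0
      have hτ : ∀ a, coeff a τ = if ha : a.degree = m + 1 then h a ha else 0 := fun a => rfl
      have hτ0 : ∀ a : Fin c →₀ ℕ, a.degree ≠ m + 1 → coeff a τ = 0 := fun a ha => by
        rw [hτ, dif_neg ha]
      refine ⟨σ + τ, ?_, ?_, ?_, ?_⟩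
      · rw [map_add, h0, hτ0 _ (by simp), add_zero]
      · intro a i x
        simp only [map_add, LinearMap.add_apply, hp]
        congr 1
        by_cases ha : a.degree = m + 1
        · rw [hτ, dif_pos ha, hh1]
        · rw [hτ0 _ ha]; simp
      · intro a ha
        have l1 := coeff_mul_low σ τ a (fun b hb => hτ0 b (by omega))
        have l2 := coeff_mul_low τ τ a (fun b hb => hτ0 b (by omega))
        rw [add_mul, mul_add, mul_add, map_add, map_add, map_add, l1.1, l1.2, l2.1, hτ0 0 (by simp),
          zero_mul, add_zero, h0]
        by_cases ha' : a.degree = m + 1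
        · have := hh2 a ha'
          rw [hτ, dif_pos ha', add_assoc, this]
          simp [E]
        · rw [hτ0 _ ha', hS a (by omega)]; simp
      · intro a ha
        rw [map_add, hl a (by omega), hτ0 a (by omega), add_zero]
  obtain ⟨σ, h0, hp, hS, hl⟩ := key (R.n + 2)
  refine ⟨fun a => coeff a σ, R.n + 2, h0, hp, ?_, hl⟩
  have : ∀ a, coeff a (σ * σ) = coeff a W := by
    intro a
    by_cases ha : a.degree ≤ R.n + 2
    · exact hS a ha
    · rw [hW, ww_eq_zero _ _ (by omega), map_zero]
      refine R.ext_p _ _ fun i x => ?_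
      by_cases hi : i < 0
      · rw [R.p_neg i (Or.inl hi)]; simp
      · rw [← Sdeg σ hp, R.p_neg _ (Or.inr (by omega))]
        simp
  intro a x
  have := congrArg (fun g => g x) (this a)
  rw [coeff_mul] at this
  simpa [hW] using this

end S6

namespace S6
variable {Q : Type} [CommRing Q]

lemma step_core {U : Type} [AddCommGroup U] [Module Q U] (D t : Module.End Q U) (f : Q)
    (H : ℤ → Submodule Q U) (hD : ∀ i, ∀ x ∈ H i, D x ∈ H (i - 1))
    (ht : ∀ i, ∀ x ∈ H i, t x ∈ H (i - 2))
    (hts : ∀ i, ∀ x ∈ H i, ∃ y ∈ H (i + 2), t y = x)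
    (hDt : ∀ x, D (t x) = t (D x))
    (hDD : ∀ i, ∀ x ∈ H i, D (D x) = f • t x)
    (hneg : ∀ i, i < 0 → ∀ x ∈ H i, x = 0)
    (hf : ∀ x : U, f • x = 0 → x = 0)
    (hV : ∀ i, 0 < i → ∀ x ∈ H i, t x = 0 → D x = 0 → ∃ y ∈ H (i + 1), t y = 0 ∧ D y = x)
    (i : ℤ) (hi : 0 < i) (x z : U) (hx : x ∈ H i) (hz : z ∈ H (i - 1)) (hxz : D x = f • z) :
    ∃ y ∈ H (i + 1), ∃ w ∈ H i, x = D y + f • w := by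
  have htP : ∀ (P : ℕ) i, ∀ x ∈ H i, (t ^ P) x ∈ H (i - 2 * P) := by
    intro P
    induction P with
    | zero => intro i x hx; simpa using hx
    | succ P ih =>
      intro i x hx
      rw [pow_succ', Module.End.mul_apply]
      have := ht _ _ (ih i x hx)
      convert this using 2
      push_cast; ring
  have htsP : ∀ (P : ℕ) i, ∀ x ∈ H i, ∃ y ∈ H (i + 2 * P), (t ^ P) y = x := by
    intro P
    induction P with
    | zero => intro i x hx; exact ⟨x, by simpa using hx, by simp⟩
    | succ P ih =>
      intro i x hx
      obtain ⟨y, hy, rfl⟩ := ih i x hx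
      obtain ⟨y', hy', rfl⟩ := hts _ y hy
      refine ⟨y', ?_, by rw [pow_succ, Module.End.mul_apply]⟩
      convert hy' using 2
      push_cast; ring
  have hDtP : ∀ (P : ℕ) x, D ((t ^ P) x) = (t ^ P) (D x) := by
    intro P
    induction P with
    | zero => intro x; simp
    | succ P ih =>
      intro x
      rw [pow_succ', Module.End.mul_apply, hDt, ih, Module.End.mul_apply]
  have hfi : ∀ x y : U, f • x = f • y → x = y := fun x y h => by
    rw [← sub_eq_zero]; apply hf; rw [smul_sub, h, sub_self]
  have key : ∀ (P : ℕ) (x z : U), x ∈ H i → z ∈ H (i - 1) → D x = f • z → (t ^ P) x = 0 →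
      ∃ y ∈ H (i + 1), ∃ w ∈ H i, x = D y + f • w := by
    intro P
    induction P with
    | zero =>
      intro x z _ _ _ h
      exact ⟨0, zero_mem _, 0, zero_mem _, by simpa using h⟩
    | succ P ih =>
      intro x z hx hz hxz hPx
      set j := i - 2 * (P : ℤ) with hj
      have hxP : (t ^ P) x ∈ H j := htP P i x hx
      have huP : (t ^ P) z ∈ H (j - 1) := by
        have := htP P _ z hz
        convert this using 2
        rw [hj]; ring
      have hDx : D ((t ^ P) x) = f • (t ^ P) z := by rw [hDtP, hxz, map_smul]
      have htx : t ((t ^ P) x) = 0 := by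
        rw [← Module.End.mul_apply, ← pow_succ', hPx]
      have htu : t ((t ^ P) z) = 0 := by
        apply hf
        rw [← map_smul, ← hDx, ← hDt, htx, map_zero]
      have hDu : D ((t ^ P) z) = 0 := by
        apply hf
        rw [← map_smul, ← hDx, hDD _ _ hxP, htx, smul_zero]
      have core : ∃ y ∈ H (j + 1), ∃ w ∈ H j, (t ^ P) x = D y + f • w := by
        rcases lt_trichotomy j 0 with h | h | h
        · exact ⟨0, zero_mem _, 0, zero_mem _, by simpa using hneg _ h _ hxP⟩
        · obtain ⟨P', rfl⟩ : ∃ P', P = P' + 1 := ⟨P - 1, by omega⟩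
          refine ⟨(t ^ P') z, ?_, 0, zero_mem _, ?_⟩
          · have := htP P' _ z hz
            convert this using 2
            rw [hj]; push_cast; ring
          · apply hfi
            rw [smul_zero, add_zero, ← map_smul D, ← map_smul (t ^ P'), ← hxz, ← hDtP,
              hDD _ _ (htP P' _ x hx), pow_succ', Module.End.mul_apply]
        · by_cases h1 : j = 1
          · obtain ⟨u', hu', htu'⟩ := hts _ _ huP
            rw [show j - 1 + 2 = j + 1 by ring] at hu'
            have hDu' : D u' ∈ H j := by
              have := hD _ _ hu'
              rwa [add_sub_cancel_right] at this
            obtain ⟨w, hw, -, hDw⟩ := hV j h ((t ^ P) x - D u') (sub_mem hxP hDu') (by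
              rw [map_sub, htx, ← hDt, htu', hDu, sub_self]) (by
              rw [map_sub, hDx, hDD _ _ hu', htu', sub_self])
            exact ⟨u' + w, add_mem hu' hw, 0, zero_mem _, by rw [map_add, hDw]; simp⟩
          · obtain ⟨v, hv, htv, hDv⟩ := hV (j - 1) (by omega) _ huP htu hDu
            rw [sub_add_cancel] at hv
            obtain ⟨w, hw, -, hDw⟩ := hV j h ((t ^ P) x - f • v)
              (sub_mem hxP (Submodule.smul_mem _ _ hv)) (by
              rw [map_sub, htx, map_smul, htv, smul_zero, sub_self]) (by
              rw [map_sub, hDx, map_smul, hDv, sub_self])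
            exact ⟨w, hw, v, hv, by rw [hDw]; simp⟩
      obtain ⟨y, hy, w, hw, hyw⟩ := core
      obtain ⟨y', hy', rfl⟩ := htsP P _ _ hy
      obtain ⟨w', hw', rfl⟩ := htsP P _ _ hw
      rw [show j + 1 + 2 * P = i + 1 by rw [hj]; ring] at hy'
      rw [show j + 2 * P = i by rw [hj]; ring] at hw'
      have hDy : D y' ∈ H i := by
        have := hD _ _ hy'
        rwa [add_sub_cancel_right] at this
      have hty : t y' ∈ H (i - 1) := by
        have := ht _ _ hy'
        rwa [show i + 1 - 2 = i - 1 by ring] at this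
      obtain ⟨y₁, hy₁, w₁, hw₁, h₁⟩ := ih (x - D y' - f • w') (z - t y' - D w')
        (sub_mem (sub_mem hx hDy) (Submodule.smul_mem _ _ hw'))
        (sub_mem (sub_mem hz hty) (hD _ _ hw'))
        (by rw [map_sub, map_sub, hxz, hDD _ _ hy', map_smul, smul_sub, smul_sub])
        (by rw [map_sub, map_sub, hyw, hDtP, map_smul]; abel)
      refine ⟨y' + y₁, add_mem hy' hy₁, w' + w₁, add_mem hw' hw₁, ?_⟩
      rw [map_add, smul_add, add_add_add_comm, ← h₁]; abel
  refine key (i.toNat + 1) x z hx hz hxz (hneg _ ?_ _ (htP _ _ _ hx))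
  push_cast; omega

/-- Graded module with a system of higher homotopies. -/
structure Ops {c : ℕ} (f : Fin c → Q) (V : Type) [AddCommGroup V] [Module Q V] where
  p : ℤ → Module.End Q V
  σ : (Fin c →₀ ℕ) → Module.End Q V
  s : Finset (Fin c →₀ ℕ)
  p_idem : ∀ i x, p i (p i x) = p i x
  p_neg : ∀ i x, i < 0 → p i x = 0
  deg : ∀ a i x, p (i + 2 * a.degree - 1) (σ a x) = σ a (p i x)
  rel : ∀ a x, ∑ b ∈ Finset.HasAntidiagonal.antidiagonal a, σ b.1 (σ b.2 x) = ww f a • x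
  supp : ∀ a, a ∉ s → σ a = 0

namespace Ops
variable {c : ℕ} {f : Fin c → Q} {V : Type} [AddCommGroup V] [Module Q V] (O : Ops f V)

/-- projection to degree i -/
noncomputable def P (i : ℤ) : Module.End Q ((Fin c →₀ ℕ) → V) :=
  LinearMap.pi fun a => O.p (i - 2 * a.degree) ∘ₗ LinearMap.proj a

/-- the differential -/
noncomputable def D : Module.End Q ((Fin c →₀ ℕ) → V) :=
  LinearMap.pi fun e => ∑ b ∈ O.s, O.σ b ∘ₗ LinearMap.proj (e + b)

/-- shift -/
noncomputable def sh (V : Type) [AddCommGroup V] [Module Q V] (b : Fin c →₀ ℕ) :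
    Module.End Q ((Fin c →₀ ℕ) → V) := LinearMap.funLeft Q V (fun e => e + b)

@[simp] lemma P_apply (i : ℤ) (x : (Fin c →₀ ℕ) → V) (a) :
    O.P i x a = O.p (i - 2 * a.degree) (x a) := rfl
@[simp] lemma D_apply (x : (Fin c →₀ ℕ) → V) (e) :
    O.D x e = ∑ b ∈ O.s, O.σ b (x (e + b)) := by simp [D]
@[simp] lemma sh_apply (b) (x : (Fin c →₀ ℕ) → V) (e) :
    sh (Q := Q) V b x e = x (e + b) := rfl

lemma P_idem (i : ℤ) (x) : O.P i (O.P i x) = O.P i x := by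
  ext a; simp [O.p_idem]

lemma P_D (i : ℤ) (x) : O.P i (O.D x) = O.D (O.P (i + 1) x) := by
  ext a
  simp only [P_apply, D_apply, map_sum]
  refine Finset.sum_congr rfl fun b _ => ?_
  rw [← O.deg]
  congr 2
  rw [map_add]; push_cast; ring

lemma sh_D (b) (x) : O.D (sh (Q := Q) V b x) = sh (Q := Q) V b (O.D x) := by
  ext e
  simp only [D_apply, sh_apply]
  refine Finset.sum_congr rfl fun a _ => ?_
  rw [add_right_comm]

lemma sh_P (b : Fin c →₀ ℕ) (i : ℤ) (x) :
    O.P (i - 2 * b.degree) (sh (Q := Q) V b x) = sh (Q := Q) V b (O.P i x) := by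
  ext e
  simp only [P_apply, sh_apply]
  congr 2
  rw [map_add]; push_cast; ring

lemma D_D (x) : O.D (O.D x) = ∑ j, f j • sh (Q := Q) V (Finsupp.single j 1) x := by
  classical
  ext e
  simp only [D_apply, Finset.sum_apply, Pi.smul_apply, sh_apply, map_sum]
  rw [← Finset.sum_product']
  let u : Finset (Fin c →₀ ℕ) := (O.s ×ˢ O.s).image (fun b => b.1 + b.2) ∪
    Finset.univ.image (fun j : Fin c => Finsupp.single j 1)
  rw [← Finset.sum_fiberwise_of_maps_to (t := u) (g := fun b => b.1 + b.2)]
  · trans ∑ a ∈ u, ww f a • x (e + a)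
    · refine Finset.sum_congr rfl fun a _ => ?_
      rw [← O.rel]
      symm
      rw [← Finset.sum_subset (s₁ := (O.s ×ˢ O.s).filter fun b => b.1 + b.2 = a)]
      · refine Finset.sum_congr rfl fun b hb => ?_
        rw [Finset.mem_filter] at hb
        rw [← hb.2, add_assoc]
      · intro b hb
        rw [Finset.mem_filter] at hb
        exact Finset.HasAntidiagonal.mem_antidiagonal.2 hb.2
      · intro b hb hb'
        rw [Finset.HasAntidiagonal.mem_antidiagonal] at hb
        by_cases h1 : b.1 ∈ O.s
        · by_cases h2 : b.2 ∈ O.s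
          · exact absurd (by simp [h1, h2, hb]) hb'
          · rw [O.supp _ h2]; simp
        · rw [O.supp _ h1]; simp
    · simp only [ww, Finset.sum_smul]
      rw [Finset.sum_comm]
      refine Finset.sum_congr rfl fun j _ => ?_
      simp only [ite_smul, zero_smul, Finset.sum_ite_eq']
      rw [if_pos]
      simp [u]
  · intro b hb
    exact Finset.mem_union_left _ (Finset.mem_image_of_mem _ hb)

/-- compatible maps -/
structure Compat {V' : Type} [AddCommGroup V'] [Module Q V'] (O : Ops f V) (O' : Ops f V')
    (π : V →ₗ[Q] V') : Prop where
  s : O.s = O'.s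
  p : ∀ i x, π (O.p i x) = O'.p i (π x)
  σ : ∀ a x, π (O.σ a x) = O'.σ a (π x)

lemma Compat.P {V' : Type} [AddCommGroup V'] [Module Q V'] {O : Ops f V} {O' : Ops f V'}
    {π : V →ₗ[Q] V'} (h : Compat O O' π) (i : ℤ) (x : (Fin c →₀ ℕ) → V) :
    (fun e => π (O.P i x e)) = O'.P i (fun e => π (x e)) := by
  ext e; simp [h.p]

lemma Compat.D {V' : Type} [AddCommGroup V'] [Module Q V'] {O : Ops f V} {O' : Ops f V'}
    {π : V →ₗ[Q] V'} (h : Compat O O' π) (x : (Fin c →₀ ℕ) → V) :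
    (fun e => π (O.D x e)) = O'.D (fun e => π (x e)) := by
  ext e; simp [h.σ, h.s]

/-- quotient by an ideal -/
def quot (O : Ops f V) (J : Ideal Q) : Ops f (V ⧸ (J • ⊤ : Submodule Q V)) where
  p i := Submodule.mapQ _ _ (O.p i) (by
    rw [← Submodule.map_le_iff_le_comap, Submodule.map_smul'']
    exact Submodule.smul_mono le_rfl le_top)
  σ i := Submodule.mapQ _ _ (O.σ i) (by
    rw [← Submodule.map_le_iff_le_comap, Submodule.map_smul'']
    exact Submodule.smul_mono le_rfl le_top)
  s := O.s
  p_idem i x := by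
    obtain ⟨x, rfl⟩ := Submodule.mkQ_surjective _ x
    simp [O.p_idem]
  p_neg i x hi := by
    obtain ⟨x, rfl⟩ := Submodule.mkQ_surjective _ x
    simp [O.p_neg _ _ hi]
  deg a i x := by
    obtain ⟨x, rfl⟩ := Submodule.mkQ_surjective _ x
    simp [O.deg]
  rel a x := by
    obtain ⟨x, rfl⟩ := Submodule.mkQ_surjective _ x
    have := congrArg (Submodule.mkQ (J • ⊤ : Submodule Q V)) (O.rel a x)
    simpa using this
  supp a ha := by
    ext x
    simp [O.supp a ha]

lemma quot_compat (O : Ops f V) (J : Ideal Q) : Compat O (O.quot J) (Submodule.mkQ _) :=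
  ⟨rfl, fun _ _ => rfl, fun _ _ => rfl⟩

end Ops
end S6

namespace S6
variable {Q : Type} [CommRing Q]

/-- ideal of the first k elements -/
def Jk {c : ℕ} (f : Fin c → Q) (k : ℕ) : Ideal Q := Ideal.span {r | ∃ j : Fin c, (j : ℕ) < k ∧ f j = r}

lemma Jk_zero {c : ℕ} (f : Fin c → Q) : Jk f 0 = ⊥ := by
  simp [Jk]

lemma Jk_succ {c : ℕ} (f : Fin c → Q) (k : ℕ) (hk : k < c) :
    Jk f (k + 1) = Jk f k ⊔ Ideal.span {f ⟨k, hk⟩} := by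
  rw [Jk, Jk, ← Ideal.span_union]
  congr 1
  ext r
  simp only [Set.mem_ofPred_eq, Set.union_singleton, Set.mem_insert_iff]
  constructor
  · rintro ⟨j, hj, rfl⟩
    by_cases h : (j : ℕ) = k
    · left; congr 1; exact Fin.ext h
    · right; exact ⟨j, by omega, rfl⟩
  · rintro (rfl | ⟨j, hj, rfl⟩)
    · exact ⟨_, by simp, rfl⟩
    · exact ⟨j, by omega, rfl⟩

lemma Jk_last {c : ℕ} (f : Fin c → Q) : Jk f c = Ideal.span (Set.range f) := by
  rw [Jk]; congr 1; ext r; simp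

lemma mem_Jk {c : ℕ} (f : Fin c → Q) (j : Fin c) (k : ℕ) (h : (j : ℕ) < k) : f j ∈ Jk f k :=
  Ideal.subset_span ⟨j, h, rfl⟩

lemma reg_Jk {c : ℕ} (f : Fin c → Q) (h : RingTheory.Sequence.IsWeaklyRegular Q (List.ofFn f))
    (k : Fin c) (q : Q) (hq : f k * q ∈ Jk f k) : q ∈ Jk f k := by
  rw [RingTheory.Sequence.isWeaklyRegular_iff_Fin] at h
  have e : Ideal.ofList ((List.ofFn f).take k) = Jk f k := by
    rw [Ideal.ofList, Jk]
    congr 1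
    ext r
    simp only [Set.mem_ofPred_eq, List.mem_take_iff_getElem, List.length_ofFn, List.getElem_ofFn]
    constructor
    · rintro ⟨i, hi, rfl⟩
      exact ⟨⟨i, by omega⟩, by simp; omega, rfl⟩
    · rintro ⟨j, hj, rfl⟩
      exact ⟨j, by omega, rfl⟩
  have h1 : IsSMulRegular (Q ⧸ (Jk f k • ⊤ : Submodule Q Q)) (f k) := by
    have := h ⟨k, by simp⟩
    simp only [List.getElem_ofFn, Fin.getElem_fin] at this
    rw [← e]; exact this
  have h2 : (Submodule.Quotient.mk q : Q ⧸ (Jk f k • ⊤ : Submodule Q Q)) = 0 := by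
    apply h1
    simp only [smul_zero]
    rw [← Submodule.Quotient.mk_smul, Submodule.Quotient.mk_eq_zero]
    simpa using hq
  rw [Submodule.Quotient.mk_eq_zero] at h2
  simpa using h2

lemma proj_reg {G : Type} [AddCommGroup G] [Module Q G] [Module.Projective Q G] (J : Ideal Q) (r : Q)
    (h : ∀ q, r * q ∈ J → q ∈ J) (g : G) (hg : r • g ∈ (J • ⊤ : Submodule Q G)) :
    g ∈ (J • ⊤ : Submodule Q G) := by
  obtain ⟨s, hs⟩ := Module.projective_def'.1 (inferInstance : Module.Projective Q G)
  have h1 : ∀ y ∈ (J • ⊤ : Submodule Q G), ∀ a, s y a ∈ J := by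
    intro y hy
    refine Submodule.smul_induction_on hy (fun r hr n _ a => ?_) fun x y hx hy a => ?_
    · rw [map_smul, Finsupp.smul_apply, smul_eq_mul]; exact J.mul_mem_right _ hr
    · rw [map_add, Finsupp.add_apply]; exact J.add_mem (hx a) (hy a)
  have h2 : ∀ a, s g a ∈ J := fun a => h _ (by simpa using h1 _ hg a)
  have h3 : Finsupp.linearCombination Q id (s g) = g := congrArg (fun f => f g) hs
  rw [← h3, Finsupp.linearCombination_apply]
  exact Submodule.sum_mem _ fun a _ => Submodule.smul_mem_smul (h2 a) trivial

open Ops in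
theorem exact_k {c : ℕ} {f : Fin c → Q} {G : Type} [AddCommGroup G] [Module Q G]
    [Module.Projective Q G] (O : Ops f G) (h0 : 0 ∈ O.s)
    (hex : ∀ i x, 0 < i → O.p i x = x → O.σ 0 x = 0 → ∃ y, O.p (i + 1) y = y ∧ O.σ 0 y = x)
    (hreg : ∀ (k : Fin c) q, f k * q ∈ Jk f k → q ∈ Jk f k) (k : ℕ) (hk : k ≤ c) :
    ∀ (V' : Type) [AddCommGroup V'] [Module Q V'] (O' : Ops f V') (π : G →ₗ[Q] V')
      (_ : Function.Surjective π) (_ : LinearMap.ker π = Jk f k • ⊤) (_ : Compat O O' π)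
      (i : ℤ) (_ : 0 < i) (x : (Fin c →₀ ℕ) → V') (_ : O'.P i x = x)
      (_ : ∀ j : Fin c, k ≤ j → sh (Q := Q) V' (Finsupp.single j 1) x = 0) (_ : O'.D x = 0),
      ∃ y, O'.P (i + 1) y = y ∧ (∀ j : Fin c, k ≤ j → sh (Q := Q) V' (Finsupp.single j 1) y = 0) ∧
        O'.D y = x := by
  classical
  induction k with
  | zero =>
    intro V' _ _ O' π hπ hker hc i hi x hPx htx hDx
    rw [Jk_zero, Submodule.bot_smul, LinearMap.ker_eq_bot] at hker
    have hx0 : ∀ e, e ≠ 0 → x e = 0 := by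
      intro e he
      obtain ⟨j, hj⟩ := Finsupp.ne_iff.1 he
      have := congrFun (htx j (Nat.zero_le _)) (e - Finsupp.single j 1)
      rw [sh_apply, tsub_add_cancel_of_le] at this
      · exact this
      · rw [Finsupp.single_le_iff]; simp at hj; omega
    have h0' : 0 ∈ O'.s := hc.s ▸ h0
    have hDs : ∀ (y : (Fin c →₀ ℕ) → V'), (∀ e, e ≠ 0 → y e = 0) →
        ∀ e, O'.D y e = if e = 0 then O'.σ 0 (y 0) else 0 := by
      intro y hy e
      rw [D_apply]
      split_ifs with he
      · subst he
        rw [Finset.sum_eq_single 0]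
        · simp
        · intro b _ hb
          rw [hy _ (by simpa using hb), map_zero]
        · exact fun h => absurd h0' h
      · refine Finset.sum_eq_zero fun b _ => ?_
        rw [hy, map_zero]
        intro h
        exact he (by simpa using (add_eq_zero.1 h).1)
    obtain ⟨g, hg⟩ := hπ (x 0)
    have e1 : O.p i g = g := by
      apply hker
      rw [hc.p, hg]
      have := congrFun hPx 0
      simpa using this
    have e2 : O.σ 0 g = 0 := by
      apply hker
      rw [hc.σ, hg, map_zero]
      have := congrFun hDx 0
      rw [hDs x hx0] at this
      simpa using this
    obtain ⟨y, hy1, hy2⟩ := hex i g hi e1 e2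
    have hys : ∀ e, e ≠ 0 → (Pi.single 0 (π y) : (Fin c →₀ ℕ) → V') e = 0 := fun e he => by
      rw [Pi.single_eq_of_ne he]
    refine ⟨Pi.single 0 (π y), ?_, ?_, ?_⟩
    · ext e
      by_cases he : e = 0
      · subst he
        simp [← hc.p, hy1]
      · rw [P_apply, hys e he, map_zero]
    · intro j _
      ext e
      rw [sh_apply, hys]
      · rfl
      · intro h
        have := (add_eq_zero.1 h).2
        simp at this
    · ext e
      rw [hDs _ hys]
      split_ifs with he
      · subst he
        rw [Pi.single_eq_same, ← hc.σ, hy2, hg]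
      · rw [hx0 e he]
  | succ k ih =>
    intro V' _ _ O' π hπ hker hc i hi x' hPx htx hDx
    have hkc : k < c := hk
    let kf : Fin c := ⟨k, hkc⟩
    let V := G ⧸ (Jk f k • ⊤ : Submodule Q G)
    let OV : Ops f V := O.quot (Jk f k)
    have hle : (Jk f k • ⊤ : Submodule Q G) ≤ LinearMap.ker π := by
      rw [hker, Jk_succ f k hkc]
      exact Submodule.smul_mono le_sup_left le_rfl
    let πb : V →ₗ[Q] V' := Submodule.liftQ _ π hle
    have hπb : Function.Surjective πb := fun v => by
      obtain ⟨g, rfl⟩ := hπ v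
      exact ⟨Submodule.Quotient.mk g, rfl⟩
    have hcb : Compat OV O' πb := by
      refine ⟨hc.s, fun i v => ?_, fun i v => ?_⟩
      · obtain ⟨v, rfl⟩ := Submodule.mkQ_surjective _ v
        exact hc.p i v
      · obtain ⟨v, rfl⟩ := Submodule.mkQ_surjective _ v
        exact hc.σ i v
    have hkerb : ∀ v, πb v = 0 → ∃ v', v = f kf • v' := by
      intro v hv
      obtain ⟨g, rfl⟩ := Submodule.mkQ_surjective _ v
      have hg : g ∈ LinearMap.ker π := hv
      rw [hker, Jk_succ f k hkc, Submodule.sup_smul, Submodule.mem_sup] at hg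
      obtain ⟨a, ha, b, hb, rfl⟩ := hg
      rw [Submodule.ideal_span_singleton_smul, Submodule.mem_smul_pointwise_iff_exists] at hb
      obtain ⟨g', -, rfl⟩ := hb
      refine ⟨Submodule.mkQ _ g', ?_⟩
      rw [map_add, map_smul]
      have : Submodule.mkQ (Jk f k • ⊤ : Submodule Q G) a = 0 := by simpa using ha
      rw [this, zero_add]
    have hfk : ∀ v : V', f kf • v = 0 := by
      intro v
      obtain ⟨g, rfl⟩ := hπ v
      rw [← map_smul, ← LinearMap.mem_ker, hker]
      exact Submodule.smul_mem_smul (mem_Jk f kf _ (by simp [kf])) trivial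
    have hfj : ∀ (j : Fin c) (v : V), (j : ℕ) < k → f j • v = 0 := by
      intro j v hj
      obtain ⟨g, rfl⟩ := Submodule.mkQ_surjective _ v
      rw [← map_smul]
      exact (Submodule.Quotient.mk_eq_zero _).2
        (Submodule.smul_mem_smul (mem_Jk f j _ hj) Submodule.mem_top)
    have hfr : ∀ v : V, f kf • v = 0 → v = 0 := by
      intro v hv
      obtain ⟨g, rfl⟩ := Submodule.mkQ_surjective _ v
      rw [← map_smul] at hv
      have hv' : f kf • g ∈ (Jk f k • ⊤ : Submodule Q G) :=
        (Submodule.Quotient.mk_eq_zero _).1 hv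
      have := proj_reg (Jk f k) (f kf) (hreg kf) g hv'
      exact (Submodule.Quotient.mk_eq_zero _).2 this
    let H : ℤ → Submodule Q ((Fin c →₀ ℕ) → V) := fun i =>
      { carrier := {x | OV.P i x = x ∧ ∀ j : Fin c, k + 1 ≤ j →
          sh (Q := Q) V (Finsupp.single j 1) x = 0}
        add_mem' := by
          rintro a b ⟨ha, ha'⟩ ⟨hb, hb'⟩
          exact ⟨by rw [map_add, ha, hb], fun j hj => by rw [map_add, ha' j hj, hb' j hj, add_zero]⟩
        zero_mem' := ⟨by rw [map_zero], fun j hj => by rw [map_zero]⟩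
        smul_mem' := by
          rintro r a ⟨ha, ha'⟩
          exact ⟨by rw [map_smul, ha], fun j hj => by rw [map_smul, ha' j hj, smul_zero]⟩ }
    have hH : ∀ i x, x ∈ H i ↔ OV.P i x = x ∧ ∀ j : Fin c, k + 1 ≤ j →
          sh (Q := Q) V (Finsupp.single j 1) x = 0 := fun i x => Iff.rfl
    -- masking
    let bad : (Fin c →₀ ℕ) → Prop := fun e => ∃ j : Fin c, k + 1 ≤ j ∧ e j ≠ 0
    let mk : ℤ → ((Fin c →₀ ℕ) → V) → ((Fin c →₀ ℕ) → V) := fun i y =>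
      OV.P i (fun e => if bad e then 0 else y e)
    have hmk : ∀ i y, mk i y ∈ H i := by
      intro i y
      refine ⟨OV.P_idem _ _, fun j hj => ?_⟩
      ext e
      have : bad (e + Finsupp.single j 1) := ⟨j, hj, by simp⟩
      simp only [sh_apply, mk, P_apply]
      rw [if_pos this, map_zero]; rfl
    have hbad : ∀ {W : Type} [AddCommGroup W] [Module Q W] (y : (Fin c →₀ ℕ) → W),
        (∀ j : Fin c, k + 1 ≤ j → sh (Q := Q) W (Finsupp.single j 1) y = 0) →
        ∀ e, bad e → y e = 0 := by
      rintro W _ _ y hy e ⟨j, hj, hej⟩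
      have := congrFun (hy j hj) (e - Finsupp.single j 1)
      rwa [sh_apply, tsub_add_cancel_of_le] at this
      rw [Finsupp.single_le_iff]; omega
    -- lift of x'
    choose lift hlift using hπb
    let x := mk i (fun e => lift (x' e))
    have hxH : x ∈ H i := hmk i _
    have hxx' : (fun e => πb (x e)) = x' := by
      rw [hcb.P]
      rw [← hPx]
      conv_rhs => rw [← hPx]
      rw [hPx]
      congr 1
      ext e
      split_ifs with hb
      · rw [map_zero, hbad x' htx e hb]
      · rw [hlift]
    have hDH : ∀ i, ∀ x ∈ H i, OV.D x ∈ H (i - 1) := by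
      rintro i x ⟨h1, h2⟩
      refine ⟨?_, fun j hj => ?_⟩
      · rw [OV.P_D, sub_add_cancel, h1]
      · rw [← OV.sh_D, h2 j hj, map_zero]
    have hDx0 : ∀ e, πb (OV.D x e) = 0 := fun e => by
      have := congrFun (hcb.D x) e
      rw [hxx', hDx] at this
      exact this
    choose z₀ hz₀ using fun e => hkerb _ (hDx0 e)
    have hxz : OV.D x = f kf • mk (i - 1) z₀ := by
      have h1 := hDH i x hxH
      rw [← map_smul, ← h1.1]
      congr 1
      ext e
      simp only [Pi.smul_apply]
      split_ifs with hb
      · rw [hbad _ h1.2 e hb, smul_zero]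
      · exact hz₀ e
    obtain ⟨y, hy, w, hw, hyw⟩ := step_core OV.D (sh (Q := Q) V (Finsupp.single kf 1)) (f kf) H hDH
      (by
        rintro i x ⟨h1, h2⟩
        refine ⟨?_, fun j hj => ?_⟩
        · have := OV.sh_P (Finsupp.single kf 1) i x
          rw [h1] at this
          simpa using this
        · ext e
          have := congrFun (h2 j hj) (e + Finsupp.single kf 1)
          simp only [sh_apply] at this ⊢
          rw [add_right_comm]; exact this)
      (by
        rintro i x ⟨h1, h2⟩
        refine ⟨fun e => if e kf = 0 then 0 else x (e - Finsupp.single kf 1), ⟨?_, fun j hj => ?_⟩, ?_⟩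
        · ext e
          rw [P_apply]
          split_ifs with he
          · rw [map_zero]
          · have := congrFun h1 (e - Finsupp.single kf 1)
            rw [P_apply] at this
            rw [← this]
            have e1 : (e - Finsupp.single kf 1) + Finsupp.single kf 1 = e :=
              tsub_add_cancel_of_le (by rw [Finsupp.single_le_iff]; omega)
            have e2 := congrArg Finsupp.degree e1
            rw [map_add, Finsupp.degree_single] at e2
            have e3 : i + 2 - 2 * (e.degree : ℤ) = i - 2 * ((e - Finsupp.single kf 1).degree : ℤ) := by
              omega
            rw [e3, OV.p_idem]
        · ext e
          have hne : j ≠ kf := by rintro rfl; simp [kf] at hj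
          simp only [sh_apply, Finsupp.add_apply, Finsupp.single_eq_of_ne hne.symm, add_zero]
          split_ifs with he
          · rfl
          · rw [hbad x h2]; · rfl
            refine ⟨j, hj, ?_⟩
            simp [Finsupp.single_eq_of_ne hne]
        · ext e
          simp)
      (fun x => OV.sh_D _ _)
      (by
        rintro i x ⟨h1, h2⟩
        rw [OV.D_D, Finset.sum_eq_single kf]
        · intro j _ hj
          by_cases hjk : (j : ℕ) < k
          · ext e
            exact hfj j _ hjk
          · rw [h2 j, smul_zero]
            have : (j : ℕ) ≠ k := fun h => hj (Fin.ext h)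
            omega
        · simp)
      (by
        rintro i hi x ⟨h1, h2⟩
        rw [← h1]
        ext e
        rw [P_apply, OV.p_neg _ _ (by omega)]; rfl)
      (by
        intro x hx
        ext e
        exact hfr _ (congrFun hx e))
      (by
        rintro i hi x ⟨h1, h2⟩ h3 h4
        have hsplit : ∀ y : (Fin c →₀ ℕ) → V, (∀ j : Fin c, k + 1 ≤ j →
          sh (Q := Q) V (Finsupp.single j 1) y = 0) → sh (Q := Q) V (Finsupp.single kf 1) y = 0 →
          ∀ j : Fin c, k ≤ j → sh (Q := Q) V (Finsupp.single j 1) y = 0 := by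
          intro y hy1 hy2 j hj
          by_cases hjk : (j : ℕ) = k
          · rw [show j = kf from Fin.ext hjk]; exact hy2
          · exact hy1 j (by omega)
        obtain ⟨y, hy1, hy2, hy3⟩ := ih (by omega) V OV (Submodule.mkQ _)
          (Submodule.mkQ_surjective _) (Submodule.ker_mkQ _) (O.quot_compat _) i hi x h1
          (hsplit x h2 h3) h4
        exact ⟨y, ⟨hy1, fun j hj => hy2 j (by omega)⟩, hy2 kf le_rfl, hy3⟩)
      i hi x _ hxH (hmk _ _) hxz
    refine ⟨fun e => πb (y e), ?_, ?_, ?_⟩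
    · rw [← hcb.P, hy.1]
    · intro j hj
      ext e
      have := congrFun (hy.2 j hj) e
      simp only [sh_apply] at this ⊢
      rw [this]; simp
    · rw [← hcb.D, ← hxx']
      ext e
      rw [hyw]
      simp [hfk]

end S6

namespace S6

/-- box of multi-indices -/
noncomputable def box (c m : ℕ) : Finset (Fin c →₀ ℕ) :=
  Finset.Iic (Finsupp.equivFunOnFinite.symm fun _ => m)

lemma mem_box {c m : ℕ} {a : Fin c →₀ ℕ} (h : a.degree ≤ m) : a ∈ box c m := by
  rw [box, Finset.mem_Iic]
  intro j
  exact (Finsupp.le_degree j a).trans h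

/-- A resolution datum over `A`. -/
structure ARes (A M : Type) (c : ℕ) [CommRing A] [AddCommGroup M] [Module A M] where
  V : Type
  [acg : AddCommGroup V]
  [mod : Module A V]
  [fin : Module.Finite A V]
  [proj : Module.Projective A V]
  O : Ops (fun _ : Fin c => (0 : A)) V
  ε : V →ₗ[A] M
  zero_mem : 0 ∈ O.s
  ε_d : ∀ x, ε (O.σ 0 x) = 0
  ε_p : ∀ i x, i ≠ 0 → ε (O.p i x) = 0
  ε_p0 : ∀ x, ε (O.p 0 x) = ε x
  ε_surj : Function.Surjective ε
  exact : ∀ i x, 0 < i → O.P i x = x → O.D x = 0 → ∃ y, O.P (i + 1) y = y ∧ O.D y = x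
  exact0 : ∀ x, O.p 0 x = x → ε x = 0 → ∃ y, O.p 1 y = y ∧ O.σ 0 y = x

attribute [instance] ARes.acg ARes.mod ARes.fin ARes.proj

open scoped TensorProduct

lemma ker_tmul {Q A G : Type} [CommRing Q] [CommRing A] [Algebra Q A] [AddCommGroup G] [Module Q G]
    (hsurj : Function.Surjective (algebraMap Q A)) :
    LinearMap.ker (TensorProduct.mk Q A G 1) =
      (RingHom.ker (algebraMap Q A) • ⊤ : Submodule Q G) := by
  let J := RingHom.ker (algebraMap Q A)
  apply le_antisymm
  · intro g hg
    -- build the map A ⊗ G → G / J G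
    let B : Q →ₗ[Q] G →ₗ[Q] (G ⧸ (J • ⊤ : Submodule Q G)) :=
      LinearMap.toSpanSingleton Q _ (Submodule.mkQ (J • ⊤ : Submodule Q G))
    have hker : LinearMap.ker (Algebra.linearMap Q A) ≤ LinearMap.ker B := by
      intro q hq
      rw [LinearMap.mem_ker]
      ext g
      change q • Submodule.mkQ (J • ⊤ : Submodule Q G) g = 0
      rw [← map_smul]
      exact (Submodule.Quotient.mk_eq_zero _).2 (Submodule.smul_mem_smul hq trivial)
    let e := (Algebra.linearMap Q A).quotKerEquivOfSurjective hsurj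
    let B' : A →ₗ[Q] G →ₗ[Q] (G ⧸ (J • ⊤ : Submodule Q G)) :=
      (Submodule.liftQ _ B hker) ∘ₗ e.symm.toLinearMap
    have h1 : B' 1 = Submodule.mkQ (J • ⊤ : Submodule Q G) := by
      have : e.symm 1 = Submodule.Quotient.mk 1 := by
        rw [LinearEquiv.symm_apply_eq]
        exact (map_one (algebraMap Q A)).symm
      simp only [B', LinearMap.comp_apply, LinearEquiv.coe_coe, this]
      rw [Submodule.liftQ_apply]
      simp [B]
    have h2 : TensorProduct.lift B' (1 ⊗ₜ g) = 0 := by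
      rw [LinearMap.mem_ker] at hg
      have hg' : (1 : A) ⊗ₜ[Q] g = 0 := hg
      rw [hg', map_zero]
    rw [TensorProduct.lift.tmul, h1] at h2
    exact (Submodule.Quotient.mk_eq_zero _).1 h2
  · rw [Submodule.smul_le]
    intro r hr n _
    rw [LinearMap.mem_ker, TensorProduct.mk_apply, TensorProduct.tmul_smul, TensorProduct.smul_tmul',
      Algebra.smul_def, RingHom.mem_ker.1 hr, zero_mul, TensorProduct.zero_tmul]

lemma surj_tmul {Q A G : Type} [CommRing Q] [CommRing A] [Algebra Q A] [AddCommGroup G] [Module Q G]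
    (hsurj : Function.Surjective (algebraMap Q A)) :
    Function.Surjective (TensorProduct.mk Q A G 1) := TensorProduct.mk_surjective Q G A hsurj

theorem exists_ARes {Q : Type} [CommRing Q]
    (c : ℕ) (f : Fin c → Q) (hreg : RingTheory.Sequence.IsWeaklyRegular Q (List.ofFn f))
    (A : Type) [CommRing A] [Algebra Q A]
    (hsurj : Function.Surjective (algebraMap Q A))
    (hker : RingHom.ker (algebraMap Q A) = Ideal.span (Set.range f))
    (M : Type) [AddCommGroup M] [Module A M] [Module Q M] [IsScalarTower Q A M]
    (R : GRes Q M) : Nonempty (ARes A M c) := by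
  have hfA : ∀ j, algebraMap Q A (f j) = 0 := fun j => by
    rw [← RingHom.mem_ker, hker]; exact Ideal.subset_span ⟨j, rfl⟩
  have hf : ∀ j (x : M), f j • x = 0 := fun j x => by
    rw [← IsScalarTower.algebraMap_smul A, hfA, zero_smul]
  obtain ⟨σ, m, h0, hdeg, hrel, hsupp⟩ := exists_sigma R f hf
  let O : Ops f R.G :=
    { p := R.p
      σ := σ
      s := box c m
      p_idem := R.p_idem
      p_neg := fun i x hi => R.p_neg i (Or.inl hi) x
      deg := hdeg
      rel := hrel
      supp := fun a ha => hsupp a (by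
        by_contra h
        exact ha (mem_box (by omega))) }
  have h1 := surj_tmul (Q := Q) (A := A) (G := R.G) hsurj
  have hww : ∀ a, algebraMap Q A (ww f a) = 0 := fun a => by
    rw [ww, map_sum]
    refine Finset.sum_eq_zero fun j _ => ?_
    split_ifs
    · exact hfA j
    · simp
  have hww0 : ∀ a, ww (fun _ : Fin c => (0 : A)) a = 0 := fun a => by
    simp [ww]
  let OA : Ops (fun _ : Fin c => (0 : A)) (A ⊗[Q] R.G) :=
    { p := fun i => (R.p i).baseChange A
      σ := fun a => (σ a).baseChange A
      s := box c m
      p_idem := fun i x => by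
        obtain ⟨x, rfl⟩ := h1 x
        simp [R.p_idem]
      p_neg := fun i x hi => by
        obtain ⟨x, rfl⟩ := h1 x
        simp [R.p_neg i (Or.inl hi)]
      deg := fun a i x => by
        obtain ⟨x, rfl⟩ := h1 x
        simp [hdeg]
      rel := fun a x => by
        obtain ⟨x, rfl⟩ := h1 x
        rw [hww0, zero_smul]
        simp only [TensorProduct.mk_apply, LinearMap.baseChange_tmul]
        rw [← TensorProduct.tmul_sum, hrel, TensorProduct.tmul_smul, TensorProduct.smul_tmul',
          Algebra.smul_def, hww, zero_mul, TensorProduct.zero_tmul]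
      supp := fun a ha => by
        rw [show σ a = 0 from O.supp a ha, LinearMap.baseChange_zero] }
  let OQ : Ops f (A ⊗[Q] R.G) :=
    { p := fun i => ((R.p i).baseChange A).restrictScalars Q
      σ := fun a => ((σ a).baseChange A).restrictScalars Q
      s := box c m
      p_idem := OA.p_idem
      p_neg := OA.p_neg
      deg := OA.deg
      rel := fun a x => by
        rw [← IsScalarTower.algebraMap_smul A, hww]
        have := OA.rel a x
        rw [hww0] at this
        exact this
      supp := fun a ha => by
        refine LinearMap.ext fun x => ?_
        exact congrArg (fun g => g x) (OA.supp a ha) }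
  let ε : A ⊗[Q] R.G →ₗ[A] M := LinearMap.liftBaseChange A R.ε
  have hε : ∀ x, ε (1 ⊗ₜ x) = R.ε x := fun x => by simp [ε]
  refine ⟨⟨A ⊗[Q] R.G, OA, ε, mem_box (by simp), ?_, ?_, ?_, ?_, ?_, ?_⟩⟩
  · intro x
    obtain ⟨x, rfl⟩ := h1 x
    simp [OA, h0, hε, R.ε_d]
  · intro i x hi
    obtain ⟨x, rfl⟩ := h1 x
    simp [OA, hε, R.ε_p i x hi]
  · intro x
    obtain ⟨x, rfl⟩ := h1 x
    simp only [OA, TensorProduct.mk_apply, LinearMap.baseChange_tmul, hε]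
    conv_rhs => rw [← R.p_sum x]
    rw [map_sum, Finset.sum_eq_single 0]
    · rfl
    · intro i _ hi
      exact R.ε_p _ _ (by exact_mod_cast hi)
    · simp
  · intro x
    obtain ⟨y, rfl⟩ := R.ε_surj x
    exact ⟨1 ⊗ₜ y, hε y⟩
  · intro i x hi hPx hDx
    have key : ∀ x, OQ.D x = OA.D x := fun x => by
      ext e; simp only [Ops.D_apply]; rfl
    obtain ⟨y, hy1, -, hy2⟩ := exact_k O (mem_box (by simp))
      (fun i x hi hx hx' => by
        obtain ⟨y, hy, hy'⟩ := R.exact i x hi hx (by rw [← h0]; exact hx')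
        exact ⟨y, hy, by rw [← hy', ← h0]⟩)
      (fun k => reg_Jk f hreg k) c le_rfl (A ⊗[Q] R.G) OQ (TensorProduct.mk Q A R.G 1) h1
      (by rw [ker_tmul hsurj, hker, Jk_last])
      ⟨rfl, fun i x => by simp [O, OQ], fun a x => by simp [O, OQ]⟩ i hi x hPx
      (fun j hj => absurd j.2 (by omega)) (by rw [key, hDx])
    exact ⟨y, hy1, by rw [← key, hy2]⟩
  · intro x hx hεx
    obtain ⟨x, rfl⟩ := h1 x
    have hx' : (1 : A) ⊗ₜ[Q] (R.p 0 x) = 1 ⊗ₜ x := by simpa [OA] using hx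
    simp only [TensorProduct.mk_apply] at hεx ⊢
    rw [← hx', hε] at hεx
    obtain ⟨y, hy, hy'⟩ := R.exact0 (R.p 0 x) (R.p_idem _ _) hεx
    refine ⟨1 ⊗ₜ y, by simp [OA, hy], by simp [OA, h0, hy', hx']⟩

end S6

namespace S6

lemma projective_pi (A V ι : Type) [CommRing A] [AddCommGroup V] [Module A V] [Module.Projective A V]
    [Fintype ι] : Module.Projective A (ι → V) := by
  classical
  exact Module.Projective.of_equiv (DirectSum.linearEquivFunOnFintype A ι fun _ => V)

namespace ARes
variable {A M : Type} {c : ℕ} [CommRing A] [AddCommGroup M] [Module A M] (R : ARes A M c)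

/-- degree i part -/
noncomputable def C (i : ℕ) : Submodule A ((Fin c →₀ ℕ) → R.V) := LinearMap.eqLocus (R.O.P i) LinearMap.id

lemma mem_C {i : ℕ} {x} : x ∈ R.C i ↔ R.O.P i x = x := Iff.rfl

lemma C_supp {i : ℕ} {x} (hx : x ∈ R.C i) (a : Fin c →₀ ℕ) (ha : a ∉ box c i) : x a = 0 := by
  rw [R.mem_C] at hx
  rw [← hx, Ops.P_apply, R.O.p_neg]
  have : ¬ a.degree ≤ i := fun h => ha (mem_box h)
  omega

/-- projection of a homogeneous generator -/
noncomputable def mkC (i : ℕ) : ((Fin c →₀ ℕ) → R.V) →ₗ[A] R.C i :=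
  (R.O.P i).codRestrict _ (fun _ => R.O.P_idem _ _)

@[simp] lemma mkC_coe (i : ℕ) (x) : (R.mkC i x : (Fin c →₀ ℕ) → R.V) = R.O.P i x := rfl

lemma mkC_self (i : ℕ) (x : R.C i) : R.mkC i x = x := Subtype.ext x.2

noncomputable def dC (i : ℕ) : R.C (i + 1) →ₗ[A] R.C i :=
  (R.O.D ∘ₗ (R.C (i + 1)).subtype).codRestrict _ (fun x => by
    have := x.2
    rw [R.mem_C] at this ⊢
    rw [LinearMap.comp_apply, R.O.P_D]
    push_cast at this
    simp [this])

@[simp] lemma dC_coe (i : ℕ) (x) : (R.dC i x : (Fin c →₀ ℕ) → R.V) = R.O.D x := rfl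

noncomputable def εC : R.C 0 →ₗ[A] M := R.ε ∘ₗ LinearMap.proj 0 ∘ₗ (R.C 0).subtype

@[simp] lemma εC_apply (x) : R.εC x = R.ε (x.1 0) := rfl

lemma dC_dC (i : ℕ) (x) : R.dC i (R.dC (i + 1) x) = 0 := by
  apply Subtype.ext
  simp [Ops.D_D]

lemma dC_exact (i : ℕ) : Function.Exact (R.dC (i + 1)) (R.dC i) := by
  intro x
  constructor
  · intro h
    obtain ⟨y, hy1, hy2⟩ := R.exact (i + 1 : ℕ) x.1 (by push_cast; omega) x.2 (congrArg Subtype.val h)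
    exact ⟨⟨y, by rw [R.mem_C]; push_cast at hy1 ⊢; exact hy1⟩, Subtype.ext hy2⟩
  · rintro ⟨y, rfl⟩
    exact R.dC_dC i y

lemma D_apply_zero (x : R.C 1) : R.O.D x.1 0 = R.O.σ 0 (x.1 0) := by
  rw [Ops.D_apply, Finset.sum_eq_single 0]
  · simp
  · intro b _ hb
    have h2 := congrFun x.2 b
    rw [Ops.P_apply, R.O.p_neg] at h2
    · rw [zero_add, ← show _ = x.1 b from h2, map_zero]
    · have : b.degree ≠ 0 := fun h => hb ((Finsupp.degree_eq_zero_iff b).1 h)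
      push_cast; omega
  · exact fun h => absurd R.zero_mem h

lemma εC_surj : Function.Surjective R.εC := by
  intro m
  obtain ⟨v, rfl⟩ := R.ε_surj m
  refine ⟨R.mkC 0 (Pi.single 0 v), ?_⟩
  simp [R.ε_p0]

lemma εC_exact : Function.Exact (R.dC 0) R.εC := by
  classical
  intro x
  constructor
  · intro h
    obtain ⟨y, hy1, hy2⟩ := R.exact0 (x.1 0) (by simpa using congrFun x.2 0) h
    refine ⟨R.mkC 1 (Pi.single 0 y), Subtype.ext (funext fun e => ?_)⟩
    by_cases he : e = 0
    · subst he
      rw [dC_coe]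
      erw [R.D_apply_zero]
      simp [hy1, hy2]
    · have hb : e.degree ≠ 0 := fun h => he ((Finsupp.degree_eq_zero_iff e).1 h)
      rw [← R.mem_C.1 (R.dC 0 (R.mkC 1 (Pi.single 0 y))).2, ← R.mem_C.1 x.2]
      simp only [Ops.P_apply]
      rw [R.O.p_neg _ _ (by push_cast; omega), R.O.p_neg _ _ (by push_cast; omega)]
  · rintro ⟨y, rfl⟩
    rw [εC_apply, dC_coe, R.D_apply_zero, R.ε_d]

instance C_proj (i : ℕ) : Module.Projective A (R.C i) := by
  classical
  have := projective_pi A R.V (box c i)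
  let r : R.C i →ₗ[A] (box c i → R.V) :=
    LinearMap.funLeft A R.V (fun a : box c i => (a : Fin c →₀ ℕ)) ∘ₗ (R.C i).subtype
  let e : (box c i → R.V) →ₗ[A] ((Fin c →₀ ℕ) → R.V) :=
    LinearMap.pi fun a => if h : a ∈ box c i then LinearMap.proj (⟨a, h⟩ : box c i) else 0
  refine Module.Projective.of_split r (R.mkC i ∘ₗ e) ?_
  ext1 x
  have : e (r x) = x.1 := by
    ext a
    by_cases h : a ∈ box c i
    · simp [e, h, r, LinearMap.funLeft]
    · simp [e, h, R.C_supp x.2 a h]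
  rw [LinearMap.comp_apply, LinearMap.comp_apply, this, R.mkC_self]; rfl

/-- the complex -/
noncomputable def cplx : ChainComplex (ModuleCat.{0} A) ℕ :=
  ChainComplex.of (fun i => ModuleCat.of A (R.C i)) (fun i => ModuleCat.ofHom (R.dC i)) (fun i => by
    refine ModuleCat.hom_ext (LinearMap.ext fun x => ?_)
    exact R.dC_dC i x)

lemma cplx_d (i : ℕ) : R.cplx.d (i + 1) i = ModuleCat.ofHom (R.dC i) := by
  simp only [cplx]
  exact ChainComplex.of_d _ _ _

noncomputable def πC : R.cplx ⟶ (ChainComplex.single₀ _).obj (ModuleCat.of A M) :=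
  (ChainComplex.toSingle₀Equiv _ _).symm ⟨ModuleCat.ofHom R.εC, by
    rw [R.cplx_d 0]
    ext x
    exact (R.εC_exact).apply_apply_eq_zero x⟩

lemma πC_f0 : R.πC.f 0 = ModuleCat.ofHom R.εC := by
  simp only [πC]
  exact ChainComplex.toSingle₀Equiv_symm_apply_f_zero _ _

noncomputable def res : ProjectiveResolution (ModuleCat.of A M) where
  complex := R.cplx
  projective i := by
    change Projective (ModuleCat.of A (R.C i))
    rw [← IsProjective.iff_projective]; infer_instance
  π := R.πC
  quasiIso := ⟨fun n => by
    cases n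
    · rw [ChainComplex.quasiIsoAt₀_iff, ShortComplex.quasiIso_iff_of_zeros']
      · constructor
        · rw [ShortComplex.ShortExact.moduleCat_exact_iff_function_exact]
          change Function.Exact (R.cplx.d 1 0).hom (R.πC.f 0).hom
          rw [R.cplx_d 0, R.πC_f0]
          exact R.εC_exact
        · change Epi (R.πC.f 0)
          rw [R.πC_f0]
          exact (ModuleCat.epi_iff_surjective _).2 R.εC_surj
      all_goals rfl
    · rw [quasiIsoAt_iff_exactAt']
      · rename_i n
        rw [HomologicalComplex.exactAt_iff' _ (n+2) (n+1) n (by simp) (by simp),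
          ShortComplex.ShortExact.moduleCat_exact_iff_function_exact]
        change Function.Exact (R.cplx.d (n + 2) (n + 1)).hom (R.cplx.d (n + 1) n).hom
        rw [R.cplx_d (n+1), R.cplx_d n]
        exact R.dC_exact n
      · apply ChainComplex.exactAt_succ_single_obj⟩

end ARes
end S6

namespace S6

lemma ass_homology {A : Type} [CommRing A] (K : CochainComplex (ModuleCat.{0} A) ℕ) (i : ℕ)
    (Z : Type) [AddCommGroup Z] [Module A Z] (Ψ : K.X i →ₗ[A] Z)
    (h1 : ∀ j ζ, Ψ ((K.d j i).hom ζ) = 0)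
    (h2 : ∀ ξ, Ψ ξ = 0 → ∃ j ζ, (K.d j i).hom ζ = ξ) :
    associatedPrimes A (K.homology i) ⊆ associatedPrimes A Z := by
  let φ : K.opcycles i ⟶ ModuleCat.of A Z :=
    K.descOpcycles (ModuleCat.ofHom Ψ) _ rfl (by
      refine ModuleCat.hom_ext (LinearMap.ext fun x => ?_)
      exact h1 _ x)
  have hφ : Function.Injective φ.hom := by
    rw [injective_iff_map_eq_zero]
    intro y hy
    have hsurj : Function.Surjective (K.pOpcycles i).hom :=
      (ModuleCat.epi_iff_surjective _).1 inferInstance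
    obtain ⟨ξ, rfl⟩ := hsurj y
    have hξ : Ψ ξ = 0 := by
      have : K.pOpcycles i ≫ φ = ModuleCat.ofHom Ψ := K.p_descOpcycles _ _ _ _
      have := congrArg (fun g => ModuleCat.Hom.hom g ξ) this
      exact this.symm.trans hy
    obtain ⟨j, ζ, rfl⟩ := h2 ξ hξ
    have := congrArg (fun g => g.hom ζ) (K.d_pOpcycles j i)
    exact this
  have hι : Function.Injective (K.homologyι i).hom :=
    (ModuleCat.mono_iff_injective _).1 inferInstance
  exact associatedPrimes.subset_of_injective (f := φ.hom ∘ₗ (K.homologyι i).hom) (hφ.comp hι)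

lemma reindex {c : ℕ} {G : Type} [AddCommMonoid G] (S S' s : Finset (Fin c →₀ ℕ))
    (h : (Fin c →₀ ℕ) → (Fin c →₀ ℕ) → G)
    (hS : ∀ a b, a + b ∉ S → h a b = 0) (hS' : ∀ a b, a ∉ S' → h a b = 0) :
    (∑ e ∈ S, ∑ b ∈ s, if b ≤ e then h (e - b) b else 0) = ∑ a ∈ S', ∑ b ∈ s, h a b := by
  rw [Finset.sum_comm, Finset.sum_comm (s := S')]
  refine Finset.sum_congr rfl fun b _ => ?_
  rw [← Finset.sum_filter]
  refine Finset.sum_bij_ne_zero (fun e _ _ => e - b) ?_ ?_ ?_ ?_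
  · intro e he hne
    by_contra hc
    exact hne (hS' _ _ hc)
  · intro e he _ e' he' _ hee
    rw [Finset.mem_filter] at he he'
    rw [← tsub_add_cancel_of_le he.2, ← tsub_add_cancel_of_le he'.2, hee]
  · intro a ha hne
    refine ⟨a + b, ?_, ?_, ?_⟩
    · rw [Finset.mem_filter]
      refine ⟨?_, le_add_self⟩
      by_contra hc
      exact hne (hS _ _ hc)
    · simpa using hne
    · simp
  · intro e _ _; rfl

/-- A copy of one module in each multidegree of another one. -/
structure Slice (A T N' : Type) [CommRing A] [CommRing T] [Algebra A T] [AddCommGroup N']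
    [Module A N'] [Module T N'] [IsScalarTower A T N'] {c : ℕ} (mon : (Fin c →₀ ℕ) → T)
    (N : Type) [AddCommGroup N] [Module A N] where
  inc : (Fin c →₀ ℕ) → N →ₗ[A] N'
  cof : (Fin c →₀ ℕ) → N' →ₗ[A] N
  cof_inc_self : ∀ a x, cof a (inc a x) = x
  cof_inc_ne : ∀ a b x, a ≠ b → cof a (inc b x) = 0
  mon_inc : ∀ a b x, mon b • inc a x = inc (a + b) x
  cof_mon : ∀ a b y, b ≤ a → cof a (mon b • y) = cof (a - b) y
  cof_mon_not : ∀ a b y, ¬ b ≤ a → cof a (mon b • y) = 0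

namespace ARes
variable {A M : Type} {c : ℕ} [CommRing A] [AddCommGroup M] [Module A M] (R : ARes A M c)
variable {T N' : Type} [CommRing T] [Algebra A T] [AddCommGroup N']
    [Module A N'] [Module T N'] [IsScalarTower A T N'] (mon : (Fin c →₀ ℕ) → T)
    {N : Type} [AddCommGroup N] [Module A N]

/-- the total differential -/
noncomputable def dX : (R.V →ₗ[A] N') →ₗ[T] (R.V →ₗ[A] N') where
  toFun η := ∑ b ∈ R.O.s, mon b • (η ∘ₗ R.O.σ b)
  map_add' η η' := by simp [LinearMap.add_comp, Finset.sum_add_distrib]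
  map_smul' t η := by
    simp only [LinearMap.smul_comp, Finset.smul_sum, RingHom.id_apply]
    exact Finset.sum_congr rfl fun b _ => smul_comm _ _ _

lemma dX_apply (η : R.V →ₗ[A] N') (g : R.V) :
    R.dX mon η g = ∑ b ∈ R.O.s, mon b • η (R.O.σ b g) := by
  simp [dX, LinearMap.sum_apply]

variable {mon} (S : Slice A T N' mon N)

/-- embed cochains -/
noncomputable def psi (i : ℕ) : (R.C i →ₗ[A] N) →ₗ[A] (R.V →ₗ[A] N') where
  toFun ξ := ∑ a ∈ box c i, S.inc a ∘ₗ ξ ∘ₗ R.mkC i ∘ₗ LinearMap.single A (fun _ => R.V) a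
  map_add' η η' := by simp [LinearMap.add_comp, LinearMap.comp_add, Finset.sum_add_distrib]
  map_smul' t η := by
    simp only [LinearMap.smul_comp, LinearMap.comp_smul, Finset.smul_sum, RingHom.id_apply]

lemma psi_apply (i : ℕ) (ξ : R.C i →ₗ[A] N) (g : R.V) :
    R.psi S i ξ g = ∑ a ∈ box c i, S.inc a (ξ (R.mkC i (Pi.single a g))) := by
  simp [psi, LinearMap.sum_apply]

/-- extract cochains -/
noncomputable def rho (i : ℕ) (η : R.V →ₗ[A] N') : R.C i →ₗ[A] N :=
  ∑ a ∈ box c i, S.cof a ∘ₗ η ∘ₗ LinearMap.proj a ∘ₗ (R.C i).subtype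

lemma rho_apply (i : ℕ) (η : R.V →ₗ[A] N') (x : R.C i) :
    R.rho S i η x = ∑ a ∈ box c i, S.cof a (η (x.1 a)) := by
  simp [rho, LinearMap.sum_apply]

lemma dC_mkC (j : ℕ) (x) : R.dC j (R.mkC (j + 1) x) = R.mkC j (R.O.D x) := by
  apply Subtype.ext
  rw [dC_coe, mkC_coe, mkC_coe, R.O.P_D]
  push_cast; rfl

lemma D_single (e : Fin c →₀ ℕ) (g : R.V) : R.O.D (Pi.single e g) =
    ∑ b ∈ R.O.s, if b ≤ e then Pi.single (e - b) (R.O.σ b g) else 0 := by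
  ext a
  rw [Ops.D_apply, Finset.sum_apply]
  refine Finset.sum_congr rfl fun b _ => ?_
  by_cases h : a + b = e
  · subst h
    simp
  · rw [Pi.single_eq_of_ne h, map_zero]
    split_ifs with hb
    · rw [Pi.single_eq_of_ne]
      rintro rfl
      exact h (tsub_add_cancel_of_le hb)
    · rfl

lemma mkC_single_eq_zero (j : ℕ) (a : Fin c →₀ ℕ) (v : R.V)
    (h : R.O.p (j - 2 * a.degree) v = 0) : R.mkC j (Pi.single a v) = 0 := by
  apply Subtype.ext
  ext e
  rw [mkC_coe, Ops.P_apply]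
  by_cases he : e = a
  · subst he; simpa using h
  · simp [Pi.single_eq_of_ne he]

lemma psi_d (j : ℕ) (ζ : R.C j →ₗ[A] N) :
    R.psi S (j + 1) (ζ ∘ₗ R.dC j) = R.dX mon (R.psi S j ζ) := by
  ext g
  rw [psi_apply, dX_apply]
  simp only [psi_apply, LinearMap.comp_apply, dC_mkC, D_single, Finset.smul_sum, S.mon_inc]
  rw [Finset.sum_comm (s := R.O.s), ← reindex (box c (j + 1)) (box c j) R.O.s
    (fun a b => S.inc (a + b) (ζ (R.mkC j (Pi.single a (R.O.σ b g)))))]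
  · refine Finset.sum_congr rfl fun e _ => ?_
    simp only [map_sum]
    refine Finset.sum_congr rfl fun b _ => ?_
    split_ifs with hb
    · rw [tsub_add_cancel_of_le hb]
    · simp
  · intro a b hab
    rw [mkC_single_eq_zero, map_zero, map_zero]
    have hd : ¬ (a + b).degree ≤ j + 1 := fun h => hab (mem_box h)
    rw [map_add] at hd
    have := R.O.deg b (j + 1 - 2 * a.degree - 2 * b.degree) g
    rw [R.O.p_neg _ g (by omega), map_zero] at this
    rw [← this]; congr 2; ring
  · intro a b ha
    have hd : ¬ a.degree ≤ j := fun h => ha (mem_box h)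
    rw [mkC_single_eq_zero, map_zero, map_zero]
    exact R.O.p_neg _ _ (by omega)

lemma sigma_eq_zero {i : ℕ} (x : R.C i) (a b : Fin c →₀ ℕ) (h : i ≤ 2 * a.degree) :
    R.O.σ b (x.1 (a + b)) = 0 := by
  have h1 := congrFun (R.mem_C.1 x.2) (a + b)
  rw [Ops.P_apply] at h1
  rw [← h1, ← R.O.deg, R.O.p_neg]
  rw [map_add]; push_cast; omega

lemma rho_aux (i : ℕ) (η : R.V →ₗ[A] N') (x : R.C i) (S' : Finset (Fin c →₀ ℕ))
    (hS' : ∀ a, a ∉ S' → i ≤ 2 * a.degree) :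
    R.rho S i (R.dX mon η) x = ∑ a ∈ S', S.cof a (η (R.O.D x.1 a)) := by
  rw [rho_apply]
  simp only [dX_apply, Ops.D_apply, map_sum]
  rw [← reindex (box c i) S' R.O.s (fun a b => S.cof a (η (R.O.σ b (x.1 (a + b)))))]
  · refine Finset.sum_congr rfl fun e _ => Finset.sum_congr rfl fun b _ => ?_
    split_ifs with hb
    · rw [S.cof_mon _ _ _ hb, tsub_add_cancel_of_le hb]
    · rw [S.cof_mon_not _ _ _ hb]
  · intro a b hab
    rw [R.C_supp x.2 _ hab]; simp
  · intro a b ha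
    rw [R.sigma_eq_zero x a b (hS' a ha)]; simp

lemma rho_d (j : ℕ) (η : R.V →ₗ[A] N') :
    R.rho S (j + 1) (R.dX mon η) = R.rho S j η ∘ₗ R.dC j := by
  ext x
  rw [R.rho_aux S (j + 1) η x (box c j), LinearMap.comp_apply, rho_apply]
  · rfl
  · intro a ha
    have : ¬ a.degree ≤ j := fun h => ha (mem_box h)
    omega

lemma rho_d0 (η : R.V →ₗ[A] N') : R.rho S 0 (R.dX mon η) = 0 := by
  ext x
  rw [R.rho_aux S 0 η x ∅ (by simp)]
  simp

lemma rho_psi (i : ℕ) (ξ : R.C i →ₗ[A] N) : R.rho S i (R.psi S i ξ) = ξ := by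
  ext x
  rw [rho_apply]
  simp only [psi_apply, map_sum]
  have : ∀ a ∈ box c i, ∑ b ∈ box c i, S.cof a (S.inc b (ξ (R.mkC i (Pi.single b (x.1 a))))) =
      ξ (R.mkC i (Pi.single a (x.1 a))) := by
    intro a ha
    rw [Finset.sum_eq_single a, S.cof_inc_self]
    · intro b _ hb
      exact S.cof_inc_ne _ _ _ hb.symm
    · exact fun h => absurd ha h
  rw [Finset.sum_congr rfl this, ← map_sum, ← map_sum]
  have h2 : ∑ a ∈ box c i, Pi.single a (x.1 a) = x.1 := by
    ext e
    rw [Finset.sum_apply]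
    simp only [Pi.single_apply]
    rw [Finset.sum_ite_eq]
    split_ifs with h
    · rfl
    · exact (R.C_supp x.2 e h).symm
  rw [h2, R.mkC_self]

/-- the cochain map into the quotient -/
theorem ext_ass (i : ℕ) (S : Slice A T N' mon N) :
    associatedPrimes A (((Ext A (ModuleCat A) i).obj (Opposite.op (ModuleCat.of A M))).obj
      (ModuleCat.of A N)) ⊆
    associatedPrimes A ((R.V →ₗ[A] N') ⧸ LinearMap.range (R.dX (N' := N') mon)) := by
  let e := (R.res.isoExt (R := A) i (ModuleCat.of A N)).toLinearEquiv
  refine (associatedPrimes.subset_of_injective (f := e.toLinearMap) e.injective).trans ?_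
  let Z := LinearMap.range (R.dX (N' := N') mon)
  let q : (R.V →ₗ[A] N') →ₗ[A] (R.V →ₗ[A] N') ⧸ Z := Z.mkQ.restrictScalars A
  have hq : ∀ x, q x = 0 ↔ x ∈ Z := fun x => Submodule.Quotient.mk_eq_zero Z
  let hom : (ModuleCat.of A (R.C i) ⟶ ModuleCat.of A N) →ₗ[A] (R.C i →ₗ[A] N) :=
    { toFun := fun f => f.hom
      map_add' := fun _ _ => rfl
      map_smul' := fun _ _ => rfl }
  refine ass_homology (R.res.complex.linearYonedaObj A (ModuleCat.of A N)) i _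
    (q ∘ₗ R.psi S i ∘ₗ hom) ?_ ?_
  · intro j ζ
    by_cases hj : j + 1 = i
    · subst hj
      refine (hq _).2 ?_
      refine ⟨R.psi S j (ModuleCat.Hom.hom (show ModuleCat.of A (R.C j) ⟶ ModuleCat.of A N from ζ)), ?_⟩
      rw [← psi_d]
      refine congrArg (R.psi S (j + 1)) ?_
      have := R.cplx_d j
      change _ = ModuleCat.Hom.hom (R.cplx.d (j + 1) j ≫
        (show ModuleCat.of A (R.C j) ⟶ ModuleCat.of A N from ζ))
      rw [this]
      rfl
    · have : (R.res.complex.linearYonedaObj A (ModuleCat.of A N)).d j i = 0 :=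
        HomologicalComplex.shape _ _ _ hj
      rw [this]
      exact map_zero _
  · intro ξ hξ
    obtain ⟨η, hη⟩ := (hq _).1 hξ
    have h3 := R.rho_psi S i (hom ξ)
    change R.dX mon η = R.psi S i (hom ξ) at hη
    rw [← hη] at h3
    cases i with
    | zero =>
      rw [rho_d0] at h3
      refine ⟨0, 0, ?_⟩
      rw [map_zero]
      exact ModuleCat.hom_ext h3
    | succ j =>
      rw [rho_d] at h3
      refine ⟨j, ModuleCat.ofHom (R.rho S j η), ?_⟩
      refine ModuleCat.hom_ext (Eq.trans ?_ h3)
      have := R.cplx_d j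
      change ModuleCat.Hom.hom (R.cplx.d (j + 1) j ≫ _) = _
      rw [this]
      rfl

end ARes
end S6

namespace S6

lemma ass_finite (A T H : Type) [CommRing A] [IsNoetherianRing A] [CommRing T] [IsNoetherianRing T]
    [Algebra A T] [AddCommGroup H] [Module A H] [Module T H] [IsScalarTower A T H]
    [Module.Finite T H] : (associatedPrimes A H).Finite := by
  refine ((associatedPrimes.finite T H).image (Ideal.comap (algebraMap A T))).subset ?_
  intro p hp
  obtain ⟨hprime, x, hx⟩ := isAssociatedPrime_iff.1 hp
  have h1 : p = (Submodule.colon (⊥ : Submodule T H) {x}).comap (algebraMap A T) := by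
    rw [hx]
    ext a
    simp [Submodule.mem_colon_singleton]
  have h2 : p ∈ ((Submodule.colon (⊥ : Submodule T H) {x}).comap (algebraMap A T)).minimalPrimes := by
    rw [← h1, Ideal.minimalPrimes_eq_subsingleton_self]
    rfl
  obtain ⟨P, hP, hPp⟩ := Ideal.exists_minimalPrimes_comap_eq _ _ h2
  refine ⟨P, ?_, hPp⟩
  exact isAssociatedPrime_iff.2 ⟨hP.1.1, Submodule.exists_eq_colon_of_mem_minimalPrimes hP⟩

open scoped TensorProduct

section
variable (A B N : Type) [CommRing A] [CommRing B] [Algebra A B] [AddCommGroup N] [Module A N]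
  [Module B N] [IsScalarTower A B N] (c : ℕ)

/-- coefficient -/
noncomputable def tcof (a : Fin c →₀ ℕ) : (MvPolynomial (Fin c) B ⊗[B] N) →ₗ[B] N :=
  (TensorProduct.lid B N).toLinearMap ∘ₗ (MvPolynomial.lcoeff B a).rTensor N

lemma tcof_tmul (a : Fin c →₀ ℕ) (t : MvPolynomial (Fin c) B) (x : N) :
    tcof B N c a (t ⊗ₜ x) = t.coeff a • x := by
  simp [tcof]

/-- inclusion of a monomial -/
noncomputable def tinc (a : Fin c →₀ ℕ) : N →ₗ[B] (MvPolynomial (Fin c) B ⊗[B] N) :=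
  TensorProduct.mk B _ N (MvPolynomial.monomial a 1)

/-- slice from a retract -/
noncomputable def tslice (L : Type) [AddCommGroup L] [Module A L] (u : L →ₗ[A] N) (r : N →ₗ[A] L)
    (hru : ∀ x, r (u x) = x) :
    Slice A (MvPolynomial (Fin c) B) (MvPolynomial (Fin c) B ⊗[B] N)
      (fun a : Fin c →₀ ℕ => MvPolynomial.monomial a (1 : B)) L where
  inc a := (tinc B N c a).restrictScalars A ∘ₗ u
  cof a := r ∘ₗ (tcof B N c a).restrictScalars A
  cof_inc_self a x := by simp [tinc, tcof_tmul, hru]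
  cof_inc_ne a b x h := by
    simp [tinc, tcof_tmul, MvPolynomial.coeff_monomial, h.symm]
  mon_inc a b x := by
    simp [tinc, TensorProduct.smul_tmul', MvPolynomial.monomial_mul, add_comm]
  cof_mon a b y h := by
    rw [LinearMap.comp_apply, LinearMap.comp_apply]
    congr 1
    simp only [LinearMap.coe_restrictScalars]
    induction y with
    | zero => simp
    | add x y hx hy => simp only [smul_add, map_add, hx, hy]
    | tmul t x =>
      rw [TensorProduct.smul_tmul', tcof_tmul, tcof_tmul, smul_eq_mul,
        MvPolynomial.coeff_monomial_mul', if_pos h, one_mul]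
  cof_mon_not a b y h := by
    rw [LinearMap.comp_apply]
    convert map_zero r
    simp only [LinearMap.coe_restrictScalars]
    induction y with
    | zero => simp
    | add x y hx hy => simp only [smul_add, map_add, hx, hy, add_zero]
    | tmul t x =>
      rw [TensorProduct.smul_tmul', tcof_tmul, smul_eq_mul,
        MvPolynomial.coeff_monomial_mul', if_neg h, zero_smul]

end

/-- The Rees module. -/
noncomputable abbrev reesMod (A : Type) [CommRing A] (I : Ideal A) (D : Type)
    [AddCommGroup D] [Module A D] := (I.stableFiltration (⊤ : Submodule A D)).submodule

section
variable (A : Type) [CommRing A] (I : Ideal A) (D : Type)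
    [AddCommGroup D] [Module A D]

lemma reesMod_finite [IsNoetherianRing A] [Module.Finite A D] :
    Module.Finite (reesAlgebra I) (reesMod A I D) := by
  rw [Module.Finite.iff_fg]
  exact ((I.stableFiltration (⊤ : Submodule A D)).submodule_fg_iff_stable
    (fun i => IsNoetherian.noetherian _)).2 (I.stableFiltration_stable ⊤)

noncomputable def reesInc (n : ℕ) : (↥(I ^ n • (⊤ : Submodule A D))) →ₗ[A] reesMod A I D :=
  LinearMap.codRestrict ((reesMod A I D).restrictScalars A)
    (PolynomialModule.lsingle A n ∘ₗ (I ^ n • (⊤ : Submodule A D)).subtype) (fun x i => by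
      rw [LinearMap.comp_apply, PolynomialModule.lsingle_apply]
      split_ifs with h
      · subst h; exact x.2
      · exact Submodule.zero_mem _)

noncomputable def reesCof (n : ℕ) : reesMod A I D →ₗ[A] (↥(I ^ n • (⊤ : Submodule A D))) where
  toFun x := ⟨x.1.coeff n, x.2 n⟩
  map_add' _ _ := rfl
  map_smul' _ _ := rfl

lemma reesCof_inc (n : ℕ) (x) : reesCof A I D n (reesInc A I D n x) = x := by
  apply Subtype.ext
  change (PolynomialModule.lsingle A n x.1).coeff n = x.1
  rw [PolynomialModule.lsingle_apply, if_pos rfl]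

end

end S6

namespace S6
open scoped TensorProduct

lemma hom_finite (A T V N' : Type) [CommRing A] [CommRing T] [IsNoetherianRing T] [Algebra A T]
    [AddCommGroup V] [Module A V] [Module.Finite A V] [AddCommGroup N'] [Module A N'] [Module T N']
    [IsScalarTower A T N'] [Module.Finite T N'] : Module.Finite T (V →ₗ[A] N') := by
  obtain ⟨n, s, hs⟩ := Module.Finite.exists_fin (R := A) (M := V)
  let e : (V →ₗ[A] N') →ₗ[T] (Fin n → N') :=
    { toFun := fun η i => η (s i)
      map_add' := fun _ _ => rfl
      map_smul' := fun _ _ => rfl }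
  refine Module.Finite.of_injective e fun η η' h => ?_
  exact LinearMap.ext_on_range hs fun i => congrFun h i

theorem ass_X (A M : Type) (c : ℕ) [CommRing A] [IsNoetherianRing A] [AddCommGroup M]
    [Module A M] (R : ARes A M c) (T N' : Type) [CommRing T] [IsNoetherianRing T] [Algebra A T]
    [AddCommGroup N'] [Module A N'] [Module T N'] [IsScalarTower A T N'] [Module.Finite T N']
    (mon : (Fin c →₀ ℕ) → T) (ι : Type) (N : ι → Type) [∀ n, AddCommGroup (N n)]
    [∀ n, Module A (N n)] (S : ∀ n, Slice A T N' mon (N n)) :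
    (⋃ n : ι, ⋃ i : ℕ, associatedPrimes A
      (((Ext A (ModuleCat A) i).obj (Opposite.op (ModuleCat.of A M))).obj
        (ModuleCat.of A (N n)))).Finite := by
  have hX : Module.Finite T (R.V →ₗ[A] N') := hom_finite _ _ _ _
  refine (ass_finite A T ((R.V →ₗ[A] N') ⧸ LinearMap.range (R.dX (N' := N') mon))).subset ?_
  exact Set.iUnion_subset fun n => Set.iUnion_subset fun i => R.ext_ass i (S n)

theorem ass_Y (A M : Type) (c : ℕ) [CommRing A] [IsNoetherianRing A] [AddCommGroup M]
    [Module A M] (R : ARes A M c) (B N : Type) [CommRing B] [IsNoetherianRing B] [Algebra A B]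
    [AddCommGroup N] [Module A N] [Module B N] [IsScalarTower A B N] [Module.Finite B N]
    (ι : Type) (L : ι → Type) [∀ n, AddCommGroup (L n)]
    [∀ n, Module A (L n)] (u : ∀ n, L n →ₗ[A] N) (r : ∀ n, N →ₗ[A] L n)
    (hru : ∀ n x, r n (u n x) = x) :
    (⋃ n : ι, ⋃ i : ℕ, associatedPrimes A
      (((Ext A (ModuleCat A) i).obj (Opposite.op (ModuleCat.of A M))).obj
        (ModuleCat.of A (L n)))).Finite :=
  ass_X A M c R (MvPolynomial (Fin c) B) (MvPolynomial (Fin c) B ⊗[B] N) _ ι L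
    (fun n => tslice A B N c _ (u n) (r n) (hru n))

theorem main_finite (A M : Type) (c : ℕ) [CommRing A] [IsNoetherianRing A] [AddCommGroup M]
    [Module A M] (R : ARes A M c) (I : Ideal A) (D : Type) [AddCommGroup D] [Module A D]
    [Module.Finite A D] :
    (⋃ n : ℕ, ⋃ i : ℕ, associatedPrimes A
      (((Ext A (ModuleCat A) i).obj (Opposite.op (ModuleCat.of A M))).obj
        (ModuleCat.of A (↥(I ^ n • (⊤ : Submodule A D)))))).Finite := by
  have := reesMod_finite A I D
  exact ass_Y A M c R (reesAlgebra I) (reesMod A I D) ℕ _ (reesInc A I D)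
    (reesCof A I D) (reesCof_inc A I D)

theorem final (Q : Type) [CommRing Q] [IsNoetherianRing Q]
    (c : ℕ) (f : Fin c → Q) (hreg : RingTheory.Sequence.IsRegular Q (List.ofFn f))
    (A : Type) [CommRing A] [Algebra Q A]
    (hsurj : Function.Surjective (algebraMap Q A))
    (hker : RingHom.ker (algebraMap Q A) = Ideal.span (Set.range f))
    (M : Type) [AddCommGroup M] [Module A M] [Module Q M] [IsScalarTower Q A M]
    [Module.Finite A M]
    (hproj : ∃ n : ℕ, ∀ (L : Type) [AddCommGroup L] [Module Q L], ∀ i : ℕ, n < i →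
      Subsingleton (((Ext Q (ModuleCat Q) i).obj (Opposite.op (ModuleCat.of Q M))).obj
        (ModuleCat.of Q L)))
    (I : Ideal A) (D : Type) [AddCommGroup D] [Module A D] [Module.Finite A D] :
    (⋃ n : ℕ, ⋃ i : ℕ, associatedPrimes A
      (((Ext A (ModuleCat A) i).obj (Opposite.op (ModuleCat.of A M))).obj
        (ModuleCat.of A (↥(I ^ n • (⊤ : Submodule A D)))))).Finite := by
  have hA : IsNoetherianRing A := isNoetherianRing_of_surjective Q A (algebraMap Q A) hsurj
  have hQA : Module.Finite Q A := Module.Finite.of_surjective (Algebra.linearMap Q A) hsurj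
  have hQM : Module.Finite Q M := Module.Finite.trans A M
  obtain ⟨n, hn⟩ := hproj
  have hpd := pd_of_ext M n (fun L _ _ => hn L (n + 1) (Nat.lt_succ_self n))
  obtain ⟨G⟩ := GRes.exists_of_pd (n + 1) M hpd
  obtain ⟨R⟩ := exists_ARes c f hreg.toIsWeaklyRegular A hsurj hker M G
  exact main_finite A M c R I D

end S6

/-- Let `Q` be Noetherian of finite Krull dimension, `f_1,…,f_c` a regular
sequence in `Q`, `A = Q/(f)`, `M` a finitely generated `A`-module of finite projective
dimension over `Q`, `I` an ideal of `A` and `D` a finitely generated `A`-module.  Then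
`⋃_{n,i} Ass_A Ext^i_A(M, IⁿD)` is a finite set. -/
theorem stmt6 (Q : Type) [CommRing Q] [IsNoetherianRing Q]
    (hdim : ringKrullDim Q < ⊤)
    (c : ℕ) (f : Fin c → Q) (hreg : RingTheory.Sequence.IsRegular Q (List.ofFn f))
    (A : Type) [CommRing A] [Algebra Q A]
    (hsurj : Function.Surjective (algebraMap Q A))
    (hker : RingHom.ker (algebraMap Q A) = Ideal.span (Set.range f))
    (M : Type) [AddCommGroup M] [Module A M] [Module Q M] [IsScalarTower Q A M]
    [Module.Finite A M]
    -- `M` has finite projective dimension over `Q`: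
    (hproj : ∃ n : ℕ, ∀ (L : Type) [AddCommGroup L] [Module Q L], ∀ i : ℕ, n < i →
      Subsingleton (extAP Q M L i))
    (I : Ideal A) (D : Type) [AddCommGroup D] [Module A D] [Module.Finite A D] :
    (⋃ n : ℕ, ⋃ i : ℕ,
      associatedPrimes A (extAP A M (↥(I ^ n • (⊤ : Submodule A D))) i)).Finite := by
  exact S6.final Q c f hreg A hsurj hker M hproj I D
end
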